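/- arXiv:math/0311381 — 2 statements merged into one kernel-verified Lean document; each statement's English description precedes it below -/
import Mathlib

section
/- Let H be a quasi-Hopf algebra over a field k with Drinfeld twist f = ∑f¹⊗f², and set q_R = ∑q¹⊗q² = ∑X¹⊗S⁻¹(αX³)X² and q_L = ∑S(x¹)αx²⊗x³. Then ∑ S(q²₂X³)f¹ ⊗ S(q¹X¹βS(q²₁X²)f²) = (id⊗S)(q_L), where Φ = ∑X¹⊗X²⊗X³, Φ⁻¹ = ∑x¹⊗x²⊗x³, and Δ(q²) = ∑q²₁⊗q²₂. -/
open scoped TensorProduct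

noncomputable section

/-- A quasi-bialgebra `(H, Δ, ε, Φ)` over a field `k`.  The comultiplication is
given both as an algebra map `Δmap : H →ₐ[k] H ⊗[k] H` and by a finite family of
Sweedler components `Δ1, Δ2` (linked by `Δ_eq`); the reassociator `Φ` and its
inverse are given by finite families of components `X1, X2, X3` resp. `x1, x2, x3`. -/
structure QuasiBialgebra (k H : Type) [Field k] [Ring H] [Algebra k H] where
  /-- index type for the Sweedler components of `Δ` -/
  J : Type
  [fJ : Fintype J]
  Δ1 : H → J → H
  Δ2 : H → J → H
  Δmap : H →ₐ[k] H ⊗[k] H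
  ε : H →ₐ[k] k
  Δ_eq : ∀ h, Δmap h = ∑ j, Δ1 h j ⊗ₜ[k] Δ2 h j
  /-- index type for the components of `Φ` -/
  I : Type
  [fI : Fintype I]
  X1 : I → H
  X2 : I → H
  X3 : I → H
  /-- index type for the components of `Φ⁻¹` -/
  I' : Type
  [fI' : Fintype I']
  x1 : I' → H
  x2 : I' → H
  x3 : I' → H
  Φ_right_inv :
    (∑ i, X1 i ⊗ₜ[k] (X2 i ⊗ₜ[k] X3 i)) * (∑ a, x1 a ⊗ₜ[k] (x2 a ⊗ₜ[k] x3 a)) = 1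
  Φ_left_inv :
    (∑ a, x1 a ⊗ₜ[k] (x2 a ⊗ₜ[k] x3 a)) * (∑ i, X1 i ⊗ₜ[k] (X2 i ⊗ₜ[k] X3 i)) = 1
  quasi_coassoc : ∀ h,
    ∑ j, ∑ j', Δ1 h j ⊗ₜ[k] (Δ1 (Δ2 h j) j' ⊗ₜ[k] Δ2 (Δ2 h j) j')
      = (∑ i, X1 i ⊗ₜ[k] (X2 i ⊗ₜ[k] X3 i))
        * (∑ j, ∑ j', Δ1 (Δ1 h j) j' ⊗ₜ[k] (Δ2 (Δ1 h j) j' ⊗ₜ[k] Δ2 h j))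
        * (∑ a, x1 a ⊗ₜ[k] (x2 a ⊗ₜ[k] x3 a))
  counit_right : ∀ h, ∑ j, ε (Δ2 h j) • Δ1 h j = h
  counit_left : ∀ h, ∑ j, ε (Δ1 h j) • Δ2 h j = h
  cocycle :
    (∑ i, (1 : H) ⊗ₜ[k] (X1 i ⊗ₜ[k] (X2 i ⊗ₜ[k] X3 i)))
      * (∑ i, ∑ j, X1 i ⊗ₜ[k] (Δ1 (X2 i) j ⊗ₜ[k] (Δ2 (X2 i) j ⊗ₜ[k] X3 i)))
      * (∑ i, X1 i ⊗ₜ[k] (X2 i ⊗ₜ[k] (X3 i ⊗ₜ[k] (1 : H))))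
    = (∑ i, ∑ j, X1 i ⊗ₜ[k] (X2 i ⊗ₜ[k] (Δ1 (X3 i) j ⊗ₜ[k] Δ2 (X3 i) j)))
      * (∑ i, ∑ j, Δ1 (X1 i) j ⊗ₜ[k] (Δ2 (X1 i) j ⊗ₜ[k] (X2 i ⊗ₜ[k] X3 i)))
  Φ_normal : ∑ i, ε (X2 i) • (X1 i ⊗ₜ[k] X3 i) = (1 : H ⊗[k] H)

attribute [instance] QuasiBialgebra.fJ QuasiBialgebra.fI QuasiBialgebra.fI'

/-- A quasi-Hopf algebra: a quasi-bialgebra together with a bijective algebra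
anti-automorphism `S` (with inverse `Sinv`) and elements `α, β` satisfying the
antipode axioms. -/
structure QuasiHopf (k H : Type) [Field k] [Ring H] [Algebra k H] extends
    QuasiBialgebra k H where
  S : H →ₗ[k] H
  Sinv : H →ₗ[k] H
  Sinv_S : ∀ h, Sinv (S h) = h
  S_Sinv : ∀ h, S (Sinv h) = h
  S_one : S 1 = 1
  S_mul : ∀ a b, S (a * b) = S b * S a
  α : H
  β : H
  antipode₁ : ∀ h, ∑ j, S (Δ1 h j) * α * Δ2 h j = ε h • α
  antipode₂ : ∀ h, ∑ j, Δ1 h j * β * S (Δ2 h j) = ε h • β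
  antipode₃ : ∑ i, X1 i * β * S (X2 i) * α * X3 i = 1
  antipode₄ : ∑ a, S (x1 a) * α * x2 a * β * S (x3 a) = 1

namespace QuasiHopf

variable {k H : Type} [Field k] [Ring H] [Algebra k H] (Q : QuasiHopf k H)

/-- index type for `∑ A¹⊗A²⊗A³⊗A⁴ = (Φ⊗1)(Δ⊗id⊗id)(Φ⁻¹)` -/
abbrev AIdx := Q.I × Q.I' × Q.J

def A1 (t : Q.AIdx) : H := Q.X1 t.1 * Q.Δ1 (Q.x1 t.2.1) t.2.2
def A2 (t : Q.AIdx) : H := Q.X2 t.1 * Q.Δ2 (Q.x1 t.2.1) t.2.2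
def A3 (t : Q.AIdx) : H := Q.X3 t.1 * Q.x2 t.2.1
def A4 (t : Q.AIdx) : H := Q.x3 t.2.1

/-- index type for `∑ B¹⊗B²⊗B³⊗B⁴ = (Δ⊗id⊗id)(Φ)(Φ⁻¹⊗1)` -/
abbrev BIdx := Q.I × Q.J × Q.I'

def B1 (t : Q.BIdx) : H := Q.Δ1 (Q.X1 t.1) t.2.1 * Q.x1 t.2.2
def B2 (t : Q.BIdx) : H := Q.Δ2 (Q.X1 t.1) t.2.1 * Q.x2 t.2.2
def B3 (t : Q.BIdx) : H := Q.X2 t.1 * Q.x3 t.2.2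
def B4 (t : Q.BIdx) : H := Q.X3 t.1

/-- `γ = ∑ S(A²)αA³ ⊗ S(A¹)αA⁴` -/
def gam1 (t : Q.AIdx) : H := Q.S (Q.A2 t) * Q.α * Q.A3 t
def gam2 (t : Q.AIdx) : H := Q.S (Q.A1 t) * Q.α * Q.A4 t

/-- `δ = ∑ B¹βS(B⁴) ⊗ B²βS(B³)` -/
def del1 (t : Q.BIdx) : H := Q.B1 t * Q.β * Q.S (Q.B4 t)
def del2 (t : Q.BIdx) : H := Q.B2 t * Q.β * Q.S (Q.B3 t)

/-- index type for the components of the Drinfeld twist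
`f = ∑ (S⊗S)(Δᵒᵖ(x¹)) γ Δ(x²βS(x³))` -/
abbrev FIdx := Q.I' × Q.J × Q.AIdx × Q.J

def f1 (t : Q.FIdx) : H :=
  Q.S (Q.Δ2 (Q.x1 t.1) t.2.1) * Q.gam1 t.2.2.1
    * Q.Δ1 (Q.x2 t.1 * Q.β * Q.S (Q.x3 t.1)) t.2.2.2
def f2 (t : Q.FIdx) : H :=
  Q.S (Q.Δ1 (Q.x1 t.1) t.2.1) * Q.gam2 t.2.2.1
    * Q.Δ2 (Q.x2 t.1 * Q.β * Q.S (Q.x3 t.1)) t.2.2.2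

/-- index type for the components of
`f⁻¹ = ∑ Δ(S(x¹)αx²) δ (S⊗S)(Δᵒᵖ(x³))` -/
abbrev GIdx := Q.I' × Q.J × Q.BIdx × Q.J

def g1 (t : Q.GIdx) : H :=
  Q.Δ1 (Q.S (Q.x1 t.1) * Q.α * Q.x2 t.1) t.2.1 * Q.del1 t.2.2.1
    * Q.S (Q.Δ2 (Q.x3 t.1) t.2.2.2)
def g2 (t : Q.GIdx) : H :=
  Q.Δ2 (Q.S (Q.x1 t.1) * Q.α * Q.x2 t.1) t.2.1 * Q.del2 t.2.2.1
    * Q.S (Q.Δ1 (Q.x3 t.1) t.2.2.2)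

/-- `q_R = ∑ X¹ ⊗ S⁻¹(αX³)X²` -/
def q1 (i : Q.I) : H := Q.X1 i
def q2 (i : Q.I) : H := Q.Sinv (Q.α * Q.X3 i) * Q.X2 i

/-- `p_R = ∑ x¹ ⊗ x²βS(x³)` -/
def p1 (a : Q.I') : H := Q.x1 a
def p2 (a : Q.I') : H := Q.x2 a * Q.β * Q.S (Q.x3 a)

/-- `p_L = ∑ X²S⁻¹(X¹β) ⊗ X³` -/
def pL1 (i : Q.I) : H := Q.X2 i * Q.Sinv (Q.X1 i * Q.β)
def pL2 (i : Q.I) : H := Q.X3 i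

/-- `q_L = ∑ S(x¹)αx² ⊗ x³` -/
def qL1 (a : Q.I') : H := Q.S (Q.x1 a) * Q.α * Q.x2 a
def qL2 (a : Q.I') : H := Q.x3 a

end QuasiHopf

namespace QuasiHopf

/-- The algebra `H ⊗ M` as a type of its own, so that the instances on iterated tensor products
are found in one step. -/
def HTensor (k H M : Type) [Field k] [Ring H] [Algebra k H] [Ring M] [Algebra k M] : Type :=
  H ⊗[k] M

namespace HTensor

variable {k H : Type} [Field k] [Ring H] [Algebra k H]
  {M N : Type} [Ring M] [Algebra k M] [Ring N] [Algebra k N]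

instance : Ring (HTensor k H M) := inferInstanceAs (Ring (H ⊗[k] M))

instance : Algebra k (HTensor k H M) := inferInstanceAs (Algebra k (H ⊗[k] M))

/-- The pure tensor `h ⊗ m`. -/
def cons (h : H) (m : M) : HTensor k H M := h ⊗ₜ[k] m

/-- The pure tensor `h ⊗ m`. -/
infixr:75 "⊠" => cons

theorem cons_add (a : H) (m n : M) : (a ⊠ (m + n) : HTensor k H M) = a ⊠ m + a ⊠ n :=
  TensorProduct.tmul_add a m n

theorem smul_cons (c : k) (a : H) (m : M) : ((c • a) ⊠ m : HTensor k H M) = c • a ⊠ m :=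
  (TensorProduct.smul_tmul' c a m).symm

theorem cons_smul (c : k) (a : H) (m : M) : (a ⊠ (c • m) : HTensor k H M) = c • a ⊠ m :=
  TensorProduct.tmul_smul c a m

@[simp] theorem zero_cons (m : M) : ((0 : H) ⊠ m : HTensor k H M) = 0 :=
  TensorProduct.zero_tmul H m

@[simp] theorem cons_zero (a : H) : (a ⊠ (0 : M) : HTensor k H M) = 0 :=
  TensorProduct.tmul_zero M a

theorem sum_cons {ι : Type} (s : Finset ι) (f : ι → H) (m : M) :
    ((∑ i ∈ s, f i) ⊠ m : HTensor k H M) = ∑ i ∈ s, f i ⊠ m :=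
  TensorProduct.sum_tmul s f m

theorem cons_sum {ι : Type} (s : Finset ι) (a : H) (f : ι → M) :
    (a ⊠ (∑ i ∈ s, f i) : HTensor k H M) = ∑ i ∈ s, a ⊠ f i :=
  TensorProduct.tmul_sum a s f

@[simp] theorem cons_mul_cons (a b : H) (m n : M) :
    (a ⊠ m * b ⊠ n : HTensor k H M) = (a * b) ⊠ (m * n) :=
  Algebra.TensorProduct.tmul_mul_tmul a b m n

theorem one_def : (1 : HTensor k H M) = 1 ⊠ 1 := rfl

@[elab_as_elim]
theorem induction_on₂ {p : HTensor k H M → Prop} (t : HTensor k H M)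
    (cons : ∀ a m, p (a ⊠ m)) (add : ∀ x y, p x → p y → p (x + y)) : p t := by
  refine TensorProduct.induction_on t ?_ cons add
  have h := cons 0 0
  rw [zero_cons] at h
  exact h

@[elab_as_elim]
theorem induction_on₃ {p : HTensor k H (HTensor k H M) → Prop} (t : HTensor k H (HTensor k H M))
    (cons : ∀ a b m, p (a ⊠ b ⊠ m)) (add : ∀ x y, p x → p y → p (x + y)) : p t := by
  refine induction_on₂ t (fun a s ↦ ?_) add
  refine induction_on₂ s (cons a) fun x y hx hy ↦ ?_
  rw [cons_add]
  exact add _ _ hx hy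

@[elab_as_elim]
theorem induction_on₄ {p : HTensor k H (HTensor k H (HTensor k H M)) → Prop}
    (t : HTensor k H (HTensor k H (HTensor k H M)))
    (cons : ∀ a b c m, p (a ⊠ b ⊠ c ⊠ m)) (add : ∀ x y, p x → p y → p (x + y)) : p t := by
  refine induction_on₃ t (fun a b s ↦ ?_) add
  refine induction_on₂ s (cons a b) fun x y hx hy ↦ ?_
  rw [cons_add, cons_add]
  exact add _ _ hx hy

@[elab_as_elim]
theorem induction_on₅ {p : HTensor k H (HTensor k H (HTensor k H (HTensor k H M))) → Prop}
    (t : HTensor k H (HTensor k H (HTensor k H (HTensor k H M))))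
    (cons : ∀ a b c d m, p (a ⊠ b ⊠ c ⊠ d ⊠ m))
    (add : ∀ x y, p x → p y → p (x + y)) : p t := by
  refine induction_on₄ t (fun a b c s ↦ ?_) add
  refine induction_on₂ s (cons a b c) fun x y hx hy ↦ ?_
  rw [cons_add, cons_add, cons_add]
  exact add _ _ hx hy

/-- `id ⊗ f` -/
def onTail (H : Type) [Ring H] [Algebra k H] (f : M →ₐ[k] N) :
    HTensor k H M →ₐ[k] HTensor k H N :=
  Algebra.TensorProduct.map (AlgHom.id k H) f

@[simp] theorem onTail_cons (f : M →ₐ[k] N) (h : H) (m : M) :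
    onTail H f (h ⊠ m) = h ⊠ f m := rfl

/-- `m ↦ 1 ⊗ m` -/
def consOne (k H M : Type) [Field k] [Ring H] [Algebra k H] [Ring M] [Algebra k M] :
    M →ₐ[k] HTensor k H M :=
  (Algebra.TensorProduct.includeRight : M →ₐ[k] H ⊗[k] M)

@[simp] theorem consOne_apply (m : M) : consOne k H M m = 1 ⊠ m := rfl

/-- `h ↦ h ⊗ 1` -/
def headOnly (k H M : Type) [Field k] [Ring H] [Algebra k H] [Ring M] [Algebra k M] :
    H →ₐ[k] HTensor k H M :=
  (Algebra.TensorProduct.includeLeft : H →ₐ[k] H ⊗[k] M)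

@[simp] theorem headOnly_apply (h : H) : headOnly k H M h = h ⊠ 1 := rfl

/-- `a ⊗ b ⊗ c ↦ a ⊗ b ⊗ c ⊗ 1` -/
def extendOne (k H M : Type) [Field k] [Ring H] [Algebra k H] [Ring M] [Algebra k M] :
    HTensor k H (HTensor k H H) →ₐ[k] HTensor k H (HTensor k H (HTensor k H M)) :=
  onTail H (onTail H (headOnly k H M))

@[simp] theorem extendOne_cons (a b c : H) : extendOne k H M (a ⊠ b ⊠ c) = a ⊠ b ⊠ c ⊠ 1 := rfl

/-- `f ⊗ g` on linear maps -/
def linMap (f : H →ₗ[k] H) (g : M →ₗ[k] N) : HTensor k H M →ₗ[k] HTensor k H N :=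
  (TensorProduct.map f g : H ⊗[k] M →ₗ[k] H ⊗[k] N)

@[simp] theorem linMap_cons (f : H →ₗ[k] H) (g : M →ₗ[k] N) (h : H) (m : M) :
    linMap f g (h ⊠ m) = f h ⊠ g m := rfl

/-- `a ⊗ b ⊗ m ↦ b ⊗ a ⊗ m` -/
def leftComm : HTensor k H (HTensor k H M) →ₗ[k] HTensor k H (HTensor k H M) :=
  ((TensorProduct.leftComm k H H M).toLinearMap : H ⊗[k] (H ⊗[k] M) →ₗ[k] H ⊗[k] (H ⊗[k] M))

@[simp] theorem leftComm_cons (a b : H) (m : M) :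
    leftComm (k := k) (a ⊠ b ⊠ m) = b ⊠ a ⊠ m := rfl

/-- `a ⊗ b ↦ b ⊗ a` -/
def swap : HTensor k H H →ₗ[k] HTensor k H H :=
  ((TensorProduct.comm k H H).toLinearMap : H ⊗[k] H →ₗ[k] H ⊗[k] H)

@[simp] theorem swap_cons (a b : H) : swap (k := k) (a ⊠ b) = b ⊠ a := rfl

/-- `a ⊗ b ⊗ m ↦ f (a ⊗ b) ⊗ m` -/
def contract (f : HTensor k H H →ₗ[k] H) : HTensor k H (HTensor k H M) →ₗ[k] HTensor k H M :=
  ((TensorProduct.map (f : H ⊗[k] H →ₗ[k] H) LinearMap.id).comp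
    (TensorProduct.assoc k H H M).symm.toLinearMap : H ⊗[k] (H ⊗[k] M) →ₗ[k] H ⊗[k] M)

@[simp] theorem contract_cons (f : HTensor k H H →ₗ[k] H) (a b : H) (m : M) :
    contract f (a ⊠ b ⊠ m) = f (a ⊠ b) ⊠ m := rfl

/-- `a ⊗ m ↦ f a * c * g m` -/
def sandwich (f : H →ₗ[k] N) (c : N) (g : M →ₗ[k] N) : HTensor k H M →ₗ[k] N :=
  (TensorProduct.lift (((LinearMap.mul k N).comp ((LinearMap.mulRight k c).comp f)).compl₂ g) :
    H ⊗[k] M →ₗ[k] N)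

@[simp] theorem sandwich_cons (f : H →ₗ[k] N) (c : N) (g : M →ₗ[k] N) (a : H) (m : M) :
    sandwich f c g (a ⊠ m) = f a * c * g m := rfl

/-- `a ⊗ b ⊗ c ⊗ m ↦ b ⊗ c ⊗ a ⊗ m` -/
def rotate : HTensor k H (HTensor k H (HTensor k H M)) →ₗ[k]
    HTensor k H (HTensor k H (HTensor k H M)) :=
  (linMap LinearMap.id leftComm).comp leftComm

@[simp] theorem rotate_cons (a b c : H) (m : M) :
    rotate (k := k) (a ⊠ b ⊠ c ⊠ m) = b ⊠ c ⊠ a ⊠ m := rfl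

end HTensor

open HTensor

variable {k H : Type} [Field k] [Ring H] [Algebra k H] (Q : QuasiHopf k H)
  (M : Type) [Ring M] [Algebra k M]

/-- The comultiplication. -/
def comul : H →ₐ[k] HTensor k H H := Q.Δmap

/-- `Δ ⊗ id` -/
def comulHead : HTensor k H M →ₐ[k] HTensor k H (HTensor k H M) :=
  ((Algebra.TensorProduct.assoc k k k H H M).toAlgHom.comp
    (Algebra.TensorProduct.map Q.Δmap (AlgHom.id k M)) : H ⊗[k] M →ₐ[k] H ⊗[k] (H ⊗[k] M))

/-- `ε ⊗ id` -/
def counitHead : HTensor k H M →ₐ[k] M :=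
  ((Algebra.TensorProduct.lid k M).toAlgHom.comp
    (Algebra.TensorProduct.map Q.ε (AlgHom.id k M)) : H ⊗[k] M →ₐ[k] M)

/-- `h ⊗ m ↦ ε(h) 1 ⊗ 1 ⊗ m` -/
def trivHead : HTensor k H M →ₐ[k] HTensor k H (HTensor k H M) :=
  (consOne k H (HTensor k H M)).comp ((consOne k H M).comp (Q.counitHead M))

variable {M}

theorem comul_apply (h : H) : Q.comul h = ∑ j, Q.Δ1 h j ⊠ Q.Δ2 h j := Q.Δ_eq h

@[simp] theorem comulHead_cons (h : H) (m : M) :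
    Q.comulHead M (h ⊠ m) = ∑ j, Q.Δ1 h j ⊠ Q.Δ2 h j ⊠ m := by
  have : (Algebra.TensorProduct.assoc k k k H H M)
      ((Algebra.TensorProduct.map Q.Δmap (AlgHom.id k M)) (h ⊗ₜ[k] m))
      = ∑ j, Q.Δ1 h j ⊗ₜ[k] (Q.Δ2 h j ⊗ₜ[k] m) := by
    simp [Q.Δ_eq, TensorProduct.sum_tmul]
  exact this

@[simp] theorem counitHead_cons (h : H) (m : M) : Q.counitHead M (h ⊠ m) = Q.ε h • m := by
  have : (Algebra.TensorProduct.lid k M)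
      ((Algebra.TensorProduct.map Q.ε (AlgHom.id k M)) (h ⊗ₜ[k] m)) = Q.ε h • m := by
    simp
  exact this

theorem trivHead_cons (h : H) (m : M) :
    Q.trivHead M (h ⊠ m) = Q.ε h • (1 ⊠ 1 ⊠ m) := by
  simp [trivHead]

/-- The reassociator `Φ`. -/
def reassoc : HTensor k H (HTensor k H H) := ∑ i, Q.X1 i ⊠ Q.X2 i ⊠ Q.X3 i

/-- The inverse reassociator `Φ⁻¹`. -/
def reassocInv : HTensor k H (HTensor k H H) := ∑ a, Q.x1 a ⊠ Q.x2 a ⊠ Q.x3 a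

theorem reassoc_mul_inv : Q.reassoc * Q.reassocInv = 1 := Q.Φ_right_inv

theorem reassocInv_mul : Q.reassocInv * Q.reassoc = 1 := Q.Φ_left_inv

theorem comul_coassoc (h : H) :
    onTail H Q.comul (Q.comul h) * Q.reassoc = Q.reassoc * Q.comulHead H (Q.comul h) := by
  have e1 : onTail H Q.comul (Q.comul h)
      = ∑ j, ∑ j', Q.Δ1 h j ⊠ Q.Δ1 (Q.Δ2 h j) j' ⊠ Q.Δ2 (Q.Δ2 h j) j' := by
    simp [comul_apply, cons_sum]
  have e2 : Q.comulHead H (Q.comul h)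
      = ∑ j, ∑ j', Q.Δ1 (Q.Δ1 h j) j' ⊠ Q.Δ2 (Q.Δ1 h j) j' ⊠ Q.Δ2 h j := by
    simp [comul_apply]
  have key : onTail H Q.comul (Q.comul h)
      = Q.reassoc * Q.comulHead H (Q.comul h) * Q.reassocInv := by
    rw [e1, e2]
    exact Q.quasi_coassoc h
  rw [key, mul_assoc _ Q.reassocInv, reassocInv_mul, mul_one]

theorem comul_coassoc_inv (h : H) :
    Q.comulHead H (Q.comul h) * Q.reassocInv = Q.reassocInv * onTail H Q.comul (Q.comul h) := by
  calc _ = Q.reassocInv * (Q.reassoc * Q.comulHead H (Q.comul h)) * Q.reassocInv := by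
        rw [← mul_assoc, reassocInv_mul, one_mul]
    _ = _ := by
        rw [← comul_coassoc, mul_assoc, mul_assoc, reassoc_mul_inv, mul_one]

theorem comulHead_coassoc (t : HTensor k H M) :
    onTail H (Q.comulHead M) (Q.comulHead M t) * extendOne k H M Q.reassoc
      = extendOne k H M Q.reassoc * Q.comulHead (HTensor k H M) (Q.comulHead M t) := by
  induction t using induction_on₂ with
  | add x y hx hy => simp only [map_add, add_mul, mul_add, hx, hy]
  | cons h m =>
    have key := congrArg (fun x ↦ extendOne k H M x * 1 ⊠ 1 ⊠ 1 ⊠ m) (Q.comul_coassoc h)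
    simp only [map_mul] at key
    have comm (x) : extendOne k H M x * 1 ⊠ 1 ⊠ 1 ⊠ m = 1 ⊠ 1 ⊠ 1 ⊠ m * extendOne k H M x := by
      induction x using induction_on₃ with
      | cons a b c => simp
      | add x y hx hy => simp only [map_add, add_mul, mul_add, hx, hy]
    have e1 : onTail H (Q.comulHead M) (Q.comulHead M (h ⊠ m))
        = extendOne k H M (onTail H Q.comul (Q.comul h)) * 1 ⊠ 1 ⊠ 1 ⊠ m := by
      simp [comul_apply, cons_sum, Finset.sum_mul]
    have e2 : Q.comulHead (HTensor k H M) (Q.comulHead M (h ⊠ m))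
        = extendOne k H M (Q.comulHead H (Q.comul h)) * 1 ⊠ 1 ⊠ 1 ⊠ m := by
      simp [comul_apply, Finset.sum_mul]
    rw [mul_assoc, comm, ← mul_assoc, mul_assoc _ _ (1 ⊠ 1 ⊠ 1 ⊠ m)] at key
    rw [e1, e2, key]

theorem pentagon :
    consOne k H _ Q.reassoc * onTail H (Q.comulHead H) Q.reassoc * extendOne k H H Q.reassoc
      = onTail H (onTail H Q.comul) Q.reassoc * Q.comulHead (HTensor k H H) Q.reassoc := by
  have e1 : onTail H (Q.comulHead H) Q.reassoc
      = ∑ i, ∑ j, Q.X1 i ⊠ Q.Δ1 (Q.X2 i) j ⊠ Q.Δ2 (Q.X2 i) j ⊠ Q.X3 i := by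
    simp [reassoc, cons_sum]
  have e2 : onTail H (onTail H Q.comul) Q.reassoc
      = ∑ i, ∑ j, Q.X1 i ⊠ Q.X2 i ⊠ Q.Δ1 (Q.X3 i) j ⊠ Q.Δ2 (Q.X3 i) j := by
    simp [reassoc, comul_apply, cons_sum]
  have e3 : Q.comulHead (HTensor k H H) Q.reassoc
      = ∑ i, ∑ j, Q.Δ1 (Q.X1 i) j ⊠ Q.Δ2 (Q.X1 i) j ⊠ Q.X2 i ⊠ Q.X3 i := by
    simp [reassoc]
  have e4 : consOne k H _ Q.reassoc = ∑ i, 1 ⊠ Q.X1 i ⊠ Q.X2 i ⊠ Q.X3 i := by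
    simp [reassoc]
  have e5 : extendOne k H H Q.reassoc = ∑ i, Q.X1 i ⊠ Q.X2 i ⊠ Q.X3 i ⊠ 1 := by
    simp [reassoc]
  rw [e1, e2, e3, e4, e5]
  exact Q.cocycle

theorem isUnit_reassoc : IsUnit Q.reassoc :=
  ⟨⟨_, _, Q.reassoc_mul_inv, Q.reassocInv_mul⟩, rfl⟩

theorem onTail_counitHead_reassoc : onTail H (Q.counitHead H) Q.reassoc = 1 := by
  have e : onTail H (Q.counitHead H) Q.reassoc = ∑ i, Q.ε (Q.X2 i) • (Q.X1 i ⊠ Q.X3 i) := by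
    simp [reassoc, cons_smul]
  rw [e]
  exact Q.Φ_normal

theorem counitHead_comulHead (t : HTensor k H M) :
    Q.counitHead (HTensor k H M) (Q.comulHead M t) = t := by
  induction t using induction_on₂ with
  | add x y hx hy => simp only [map_add, hx, hy]
  | cons h m =>
    conv_rhs => rw [← Q.counit_left h]
    simp [sum_cons, smul_cons]

theorem onTail_counitHead_comulHead (t : HTensor k H M) :
    onTail H (Q.counitHead M) (Q.comulHead M t) = t := by
  induction t using induction_on₂ with
  | add x y hx hy => simp only [map_add, hx, hy]
  | cons h m =>
    conv_rhs => rw [← Q.counit_right h]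
    simp [sum_cons, smul_cons, cons_smul]

theorem counitHead_comul (h : H) : Q.counitHead H (Q.comul h) = h := by
  simp [comul_apply, Q.counit_left]

theorem counitHead_reassoc : Q.counitHead (HTensor k H H) Q.reassoc = 1 := by
  have key := congrArg (onTail H (Q.counitHead (HTensor k H H))) Q.pentagon
  simp only [map_mul] at key
  have e1 : onTail H (Q.counitHead (HTensor k H H)) (consOne k H _ Q.reassoc)
      = consOne k H _ (Q.counitHead (HTensor k H H) Q.reassoc) := rfl
  have e2 : onTail H (Q.counitHead (HTensor k H H)) (onTail H (Q.comulHead H) Q.reassoc)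
      = Q.reassoc := by
    generalize Q.reassoc = t
    induction t using induction_on₂ with
    | add x y hx hy => simp only [map_add, hx, hy]
    | cons h m => rw [onTail_cons, onTail_cons, counitHead_comulHead]
  have e3 : onTail H (Q.counitHead (HTensor k H H)) (extendOne k H H Q.reassoc) = 1 := by
    have h (t) : onTail H (Q.counitHead (HTensor k H H)) (extendOne k H H t)
        = onTail H (headOnly k H H) (onTail H (Q.counitHead H) t) := by
      induction t using induction_on₃ with
      | add x y hx hy => simp only [map_add, hx, hy]
      | cons a b c => simp
    rw [h, onTail_counitHead_reassoc, map_one]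
  have e4 : onTail H (Q.counitHead (HTensor k H H)) (onTail H (onTail H Q.comul) Q.reassoc)
      = 1 := by
    have h (t) : onTail H (Q.counitHead (HTensor k H H)) (onTail H (onTail H Q.comul) t)
        = onTail H Q.comul (onTail H (Q.counitHead H) t) := by
      induction t using induction_on₃ with
      | add x y hx hy => simp only [map_add, hx, hy]
      | cons a b c => simp
    rw [h, onTail_counitHead_reassoc, map_one]
  rw [e1, e2, e3, e4, onTail_counitHead_comulHead, mul_one] at key
  have h := Q.isUnit_reassoc.mul_right_cancel key
  have h' := congrArg (Q.counitHead (HTensor k H H)) h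
  simpa using h'

theorem onTail_onTail_counit_reassoc :
    onTail H (onTail H ((Algebra.ofId k M).comp Q.ε)) Q.reassoc = 1 := by
  have key := congrArg (onTail H (onTail H (Q.counitHead H))) Q.pentagon
  simp only [map_mul] at key
  have e1 : onTail H (onTail H (Q.counitHead H)) (consOne k H _ Q.reassoc) = 1 := by
    have h : onTail H (onTail H (Q.counitHead H)) (consOne k H _ Q.reassoc)
        = consOne k H _ (onTail H (Q.counitHead H) Q.reassoc) := rfl
    rw [h, onTail_counitHead_reassoc, map_one]
  have e2 : onTail H (onTail H (Q.counitHead H)) (onTail H (Q.comulHead H) Q.reassoc)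
      = Q.reassoc := by
    generalize Q.reassoc = t
    induction t using induction_on₂ with
    | add x y hx hy => simp only [map_add, hx, hy]
    | cons h m => rw [onTail_cons, onTail_cons, onTail_counitHead_comulHead]
  have e3 : onTail H (onTail H (Q.counitHead H)) (extendOne k H H Q.reassoc)
      = onTail H (onTail H ((Algebra.ofId k H).comp Q.ε)) Q.reassoc := by
    generalize Q.reassoc = t
    induction t using induction_on₃ with
    | add x y hx hy => simp only [map_add, hx, hy]
    | cons a b c => simp [Algebra.ofId_apply, Algebra.algebraMap_eq_smul_one]
  have e4 : onTail H (onTail H (Q.counitHead H)) (onTail H (onTail H Q.comul) Q.reassoc)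
      = Q.reassoc := by
    generalize Q.reassoc = t
    induction t using induction_on₃ with
    | add x y hx hy => simp only [map_add, hx, hy]
    | cons a b c => rw [onTail_cons, onTail_cons, onTail_cons, onTail_cons, counitHead_comul]
  have e5 : onTail H (onTail H (Q.counitHead H)) (Q.comulHead (HTensor k H H) Q.reassoc) = 1 := by
    have h (t) : onTail H (onTail H (Q.counitHead H)) (Q.comulHead (HTensor k H H) t)
        = Q.comulHead H (onTail H (Q.counitHead H) t) := by
      induction t using induction_on₃ with
      | add x y hx hy => simp only [map_add, hx, hy]
      | cons a b c => simp
    rw [h, onTail_counitHead_reassoc, map_one]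
  rw [e1, e2, e3, e4, e5, one_mul] at key
  have h : onTail H (onTail H ((Algebra.ofId k H).comp Q.ε)) Q.reassoc = 1 :=
    Q.isUnit_reassoc.mul_left_cancel key
  have h' := congrArg (onTail H (onTail H ((Algebra.ofId k M).comp Q.ε))) h
  rw [map_one] at h'
  rw [← h']
  generalize Q.reassoc = t
  induction t using induction_on₃ with
  | add x y hx hy => simp only [map_add, hx, hy]
  | cons a b c => simp [Algebra.ofId_apply]

/-- `a ⊗ b ↦ S(a)αb` -/
def pairα : HTensor k H H →ₗ[k] H := sandwich Q.S Q.α LinearMap.id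

/-- `a ⊗ b ↦ aβS(b)` -/
def pairβ : HTensor k H H →ₗ[k] H := sandwich LinearMap.id Q.β Q.S

@[simp] theorem pairα_cons (a b : H) : Q.pairα (a ⊠ b) = Q.S a * Q.α * b := rfl

@[simp] theorem pairβ_cons (a b : H) : Q.pairβ (a ⊠ b) = a * Q.β * Q.S b := rfl

/-- `a ⊗ b ↦ S(b) ⊗ S(a)` -/
def swapS : HTensor k H H →ₗ[k] HTensor k H H := (linMap Q.S Q.S).comp swap

@[simp] theorem swapS_cons (a b : H) : Q.swapS (a ⊠ b) = Q.S b ⊠ Q.S a := rfl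

theorem swapS_one : Q.swapS 1 = 1 := by
  simp [one_def, Q.S_one]

theorem swapS_mul (s t : HTensor k H H) : Q.swapS (s * t) = Q.swapS t * Q.swapS s := by
  induction s using induction_on₂ with
  | add x y hx hy => simp only [map_add, add_mul, mul_add, hx, hy]
  | cons a b =>
    induction t using induction_on₂ with
    | add x y hx hy => simp only [map_add, add_mul, mul_add, hx, hy]
    | cons c d => simp [Q.S_mul]

theorem sum_antipode_α (a b h : H) :
    ∑ j, Q.S (Q.Δ1 h j * a) * Q.α * (Q.Δ2 h j * b) = Q.ε h • (Q.S a * Q.α * b) := by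
  calc _ = Q.S a * (∑ j, Q.S (Q.Δ1 h j) * Q.α * Q.Δ2 h j) * b := by
        simp only [Q.S_mul, Finset.mul_sum, Finset.sum_mul, mul_assoc]
    _ = _ := by simp [Q.antipode₁]

theorem sum_antipode_β (a b h : H) :
    ∑ j, a * Q.Δ1 h j * Q.β * Q.S (b * Q.Δ2 h j) = Q.ε h • (a * Q.β * Q.S b) := by
  calc _ = a * (∑ j, Q.Δ1 h j * Q.β * Q.S (Q.Δ2 h j)) * Q.S b := by
        simp only [Q.S_mul, Finset.mul_sum, Finset.sum_mul, mul_assoc]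
    _ = _ := by simp [Q.antipode₂]

/-- `a ⊗ b ⊗ c ⊗ d ↦ S(b)αc ⊗ S(a)αd` -/
def nestedα : HTensor k H (HTensor k H (HTensor k H H)) →ₗ[k] HTensor k H H :=
  (linMap LinearMap.id Q.pairα).comp ((contract Q.pairα).comp rotate)

@[simp] theorem nestedα_cons (a b c d : H) :
    Q.nestedα (a ⊠ b ⊠ c ⊠ d) = (Q.S b * Q.α * c) ⊠ (Q.S a * Q.α * d) := rfl

theorem nestedα_comulHead_mul (u : HTensor k H (HTensor k H H))
    (w : HTensor k H (HTensor k H (HTensor k H H))) :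
    Q.nestedα (onTail H (Q.comulHead H) u * w) = Q.nestedα (onTail H (Q.trivHead H) u * w) := by
  induction u using induction_on₃ with
  | add x y hx hy => simp only [map_add, add_mul, hx, hy]
  | cons h h' m =>
    induction w using induction_on₄ with
    | add x y hx hy => simp only [map_add, mul_add, hx, hy]
    | cons a b c d =>
      simp [trivHead_cons, cons_sum, cons_smul, Finset.sum_mul, ← sum_cons, sum_antipode_α,
        smul_cons]

theorem nestedα_mul_comulHead (w : HTensor k H (HTensor k H (HTensor k H H)))
    (a : H) (v : HTensor k H H) :
    Q.nestedα (w * Q.comulHead (HTensor k H H) (a ⊠ v))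
      = Q.swapS (Q.comul a) * Q.nestedα w * v := by
  induction w using induction_on₄ with
  | add x y hx hy => simp only [map_add, add_mul, mul_add, hx, hy]
  | cons c₁ c₂ c₃ c₄ =>
    induction v using induction_on₂ with
    | add x y hx hy => simp only [cons_add, map_add, mul_add, hx, hy]
    | cons x y =>
      simp [comul_apply, Finset.mul_sum, Finset.sum_mul, Q.S_mul, mul_assoc]

/-- `∑ A¹ ⊗ A² ⊗ A³ ⊗ A⁴ = (Φ ⊗ 1)(Δ ⊗ id ⊗ id)(Φ⁻¹)` -/
def tensorA : HTensor k H (HTensor k H (HTensor k H H)) :=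
  extendOne k H H Q.reassoc * Q.comulHead (HTensor k H H) Q.reassocInv

/-- `γ = ∑ S(A²)αA³ ⊗ S(A¹)αA⁴` -/
def gam : HTensor k H H := Q.nestedα Q.tensorA

theorem tensorA_mul_comulHead (h : H) :
    Q.tensorA * Q.comulHead _ (onTail H Q.comul (Q.comul h))
      = onTail H (Q.comulHead H) (Q.comulHead H (Q.comul h)) * Q.tensorA := by
  rw [tensorA, mul_assoc, ← map_mul, ← comul_coassoc_inv, map_mul, ← mul_assoc,
    ← comulHead_coassoc, mul_assoc]

theorem onTail_trivHead_comulHead (t : HTensor k H M) :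
    onTail H (Q.trivHead M) (Q.comulHead M t)
      = onTail H ((consOne k H _).comp (consOne k H M)) t := by
  conv_rhs => rw [← Q.onTail_counitHead_comulHead t]
  generalize Q.comulHead M t = t
  induction t using induction_on₂ with
  | add x y hx hy => simp only [map_add, hx, hy]
  | cons h m => rfl

/-- `a ⊗ b ↦ (S ⊗ S)(Δᵒᵖ(a)) γ Δ(b)` -/
def twistγ : HTensor k H H →ₗ[k] HTensor k H H :=
  sandwich (Q.swapS.comp Q.comul.toLinearMap) Q.gam Q.comul.toLinearMap

@[simp] theorem twistγ_cons (a b : H) :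
    Q.twistγ (a ⊠ b) = Q.swapS (Q.comul a) * Q.gam * Q.comul b := rfl

theorem twistγ_eq (t : HTensor k H H) :
    Q.twistγ t = Q.nestedα (Q.tensorA * Q.comulHead _ (onTail H Q.comul t)) := by
  induction t using induction_on₂ with
  | add x y hx hy => simp only [map_add, mul_add, hx, hy]
  | cons a b => rw [onTail_cons, nestedα_mul_comulHead, twistγ_cons, gam]

theorem twistγ_comul (h : H) : Q.twistγ (Q.comul h) = Q.ε h • Q.gam := by
  rw [twistγ_eq, tensorA_mul_comulHead, nestedα_comulHead_mul, onTail_trivHead_comulHead, gam]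
  generalize Q.tensorA = w
  induction w using induction_on₄ with
  | add x y hx hy => simp only [map_add, mul_add, smul_add, hx, hy]
  | cons a b c d =>
    simp [comul_apply, Finset.sum_mul, ← cons_sum, sum_antipode_α, cons_smul]

theorem sum_twistγ (h : H) :
    ∑ j, Q.swapS (Q.comul (Q.Δ1 h j)) * Q.gam * Q.comul (Q.Δ2 h j) = Q.ε h • Q.gam := by
  rw [← twistγ_comul, comul_apply Q h, map_sum]
  rfl

theorem twistγ_linMap_comulHead_mul (g : HTensor k H M →ₗ[k] H)
    (hg : ∀ h b m, g ((h * b) ⊠ m) = h * g (b ⊠ m)) (t : HTensor k H M)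
    (w : HTensor k H (HTensor k H M)) :
    Q.twistγ (linMap LinearMap.id g (Q.comulHead M t * w))
      = Q.twistγ (linMap LinearMap.id g (Q.trivHead M t * w)) := by
  induction t using induction_on₂ with
  | add x y hx hy => simp only [map_add, add_mul, hx, hy]
  | cons h m =>
    induction w using induction_on₃ with
    | add x y hx hy => simp only [map_add, mul_add, hx, hy]
    | cons a b n =>
      have key := congrArg (fun x ↦ Q.swapS (Q.comul a) * x * Q.comul (g (b ⊠ (m * n))))
        (Q.sum_twistγ h)
      simp only [Finset.mul_sum, Finset.sum_mul] at key
      simp only [comulHead_cons, trivHead_cons, Finset.sum_mul, cons_mul_cons, map_sum,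
        linMap_cons, hg, LinearMap.id_apply, twistγ_cons, map_mul, swapS_mul, smul_mul_assoc,
        map_smul, one_mul]
      simpa [mul_assoc] using key

/-- The Drinfeld twist as a function of its reassociator:
`a ⊗ b ⊗ c ↦ (S ⊗ S)(Δᵒᵖ(a)) γ Δ(bβS(c))`. -/
def twistFun : HTensor k H (HTensor k H H) →ₗ[k] HTensor k H H :=
  Q.twistγ.comp (linMap LinearMap.id Q.pairβ)

@[simp] theorem twistFun_cons (a b c : H) :
    Q.twistFun (a ⊠ b ⊠ c) = Q.swapS (Q.comul a) * Q.gam * Q.comul (b * Q.β * Q.S c) := rfl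

/-- The Drinfeld twist `f`. -/
def twist : HTensor k H H := Q.twistFun Q.reassocInv

theorem twistFun_comulHead_mul (t : HTensor k H H) (w : HTensor k H (HTensor k H H)) :
    Q.twistFun (Q.comulHead H t * w) = Q.twistFun (Q.trivHead H t * w) :=
  Q.twistγ_linMap_comulHead_mul Q.pairβ (by simp [mul_assoc]) t w

theorem twistFun_mul_onTail_comul (t : HTensor k H H) (w : HTensor k H (HTensor k H H)) :
    Q.twistFun (w * onTail H Q.comul t)
      = Q.twistFun (w * onTail H ((Algebra.ofId k _).comp Q.ε) t) := by
  induction t using induction_on₂ with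
  | add x y hx hy => simp only [map_add, mul_add, hx, hy]
  | cons h m =>
    induction w using induction_on₃ with
    | add x y hx hy => simp only [map_add, add_mul, hx, hy]
    | cons a b c =>
      have e : onTail H Q.comul (h ⊠ m) = ∑ j, h ⊠ Q.Δ1 m j ⊠ Q.Δ2 m j := by
        rw [onTail_cons, comul_apply, cons_sum]
      simp only [e, Finset.mul_sum, map_sum, cons_mul_cons, twistFun_cons]
      rw [← Finset.mul_sum, ← map_sum, sum_antipode_β]
      simp [Algebra.ofId_apply, Algebra.algebraMap_eq_smul_one, cons_smul, one_def]

theorem twist_mul_comul_S (h : H) :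
    Q.twist * Q.comul (Q.S h) = Q.swapS (Q.comul h) * Q.twist := by
  have e1 (w) : Q.twistFun (Q.trivHead H (Q.comul h) * w)
      = Q.twistFun w * Q.comul (Q.S h) := by
    rw [trivHead, AlgHom.comp_apply, AlgHom.comp_apply, counitHead_comul]
    induction w using induction_on₃ with
    | add x y hx hy => simp only [map_add, add_mul, mul_add, hx, hy]
    | cons a b c => simp [Q.S_mul, mul_assoc]
  have e2 (w) : Q.twistFun (w * onTail H ((Algebra.ofId k _).comp Q.ε) (Q.comul h))
      = Q.swapS (Q.comul h) * Q.twistFun w := by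
    have h' : onTail H ((Algebra.ofId k (HTensor k H H)).comp Q.ε) (Q.comul h) = h ⊠ 1 := by
      conv_rhs => rw [← Q.counit_right h]
      simp [comul_apply, Algebra.ofId_apply, Algebra.algebraMap_eq_smul_one, cons_smul, sum_cons,
        smul_cons]
    rw [h']
    induction w using induction_on₃ with
    | add x y hx hy => simp only [map_add, add_mul, mul_add, hx, hy]
    | cons a b c => simp [one_def, swapS_mul, mul_assoc]
  rw [twist, ← e1, ← twistFun_comulHead_mul, comul_coassoc_inv, twistFun_mul_onTail_comul, e2]

/-- `a ⊗ b ⊗ c ↦ aβS(b)αc` -/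
def pairβα : HTensor k H (HTensor k H H) →ₗ[k] H :=
  (sandwich LinearMap.id Q.α LinearMap.id).comp (contract Q.pairβ)

@[simp] theorem pairβα_cons (a b c : H) :
    Q.pairβα (a ⊠ b ⊠ c) = a * Q.β * Q.S b * Q.α * c := rfl

/-- `a ⊗ b ⊗ c ⊗ d ↦ (S ⊗ S)(Δᵒᵖ(a)) γ Δ(bβS(c)αd)` -/
def twistFunα : HTensor k H (HTensor k H (HTensor k H H)) →ₗ[k] HTensor k H H :=
  Q.twistγ.comp (linMap LinearMap.id Q.pairβα)

@[simp] theorem twistFunα_cons (a b c d : H) : Q.twistFunα (a ⊠ b ⊠ c ⊠ d)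
    = Q.swapS (Q.comul a) * Q.gam * Q.comul (b * Q.β * Q.S c * Q.α * d) := rfl

theorem twistFunα_comulHead_mul (t : HTensor k H (HTensor k H H))
    (w : HTensor k H (HTensor k H (HTensor k H H))) :
    Q.twistFunα (Q.comulHead _ t * w) = Q.twistFunα (Q.trivHead _ t * w) := by
  refine Q.twistγ_linMap_comulHead_mul Q.pairβα (fun h b m ↦ ?_) t w
  induction m using induction_on₂ with
  | add x y hx hy => simp only [cons_add, map_add, mul_add, hx, hy]
  | cons c d => simp [mul_assoc]

theorem twistFunα_onTail_comul_mul (t : HTensor k H (HTensor k H H))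
    (w : HTensor k H (HTensor k H (HTensor k H H))) :
    Q.twistFunα (onTail H (onTail H Q.comul) t * w)
      = Q.twistFunα (onTail H (onTail H ((Algebra.ofId k _).comp Q.ε)) t * w) := by
  induction t using induction_on₃ with
  | add x y hx hy => simp only [map_add, add_mul, hx, hy]
  | cons t₁ t₂ h =>
    induction w using induction_on₄ with
    | add x y hx hy => simp only [map_add, mul_add, hx, hy]
    | cons a b c d =>
      have e : onTail H (onTail H Q.comul) (t₁ ⊠ t₂ ⊠ h)
          = ∑ j, t₁ ⊠ t₂ ⊠ Q.Δ1 h j ⊠ Q.Δ2 h j := by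
        rw [onTail_cons, onTail_cons, comul_apply, cons_sum, cons_sum]
      simp only [e, Finset.sum_mul, map_sum, cons_mul_cons, twistFunα_cons]
      rw [← Finset.mul_sum, ← map_sum]
      have e' : ∑ j, t₂ * b * Q.β * Q.S (Q.Δ1 h j * c) * Q.α * (Q.Δ2 h j * d)
          = Q.ε h • (t₂ * b * Q.β * Q.S c * Q.α * d) := by
        have := congrArg (fun x ↦ t₂ * b * Q.β * x) (Q.sum_antipode_α c d h)
        simpa [Finset.mul_sum, mul_assoc] using this
      rw [e']
      simp [Algebra.ofId_apply, Algebra.algebraMap_eq_smul_one, cons_smul, one_def]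

theorem twistFunα_mul_onTail_comulHead (t : HTensor k H (HTensor k H H))
    (w : HTensor k H (HTensor k H (HTensor k H H))) :
    Q.twistFunα (w * onTail H (Q.comulHead H) t)
      = Q.twistFunα (w * onTail H (Q.trivHead H) t) := by
  induction t using induction_on₃ with
  | add x y hx hy => simp only [map_add, mul_add, hx, hy]
  | cons t h m =>
    induction w using induction_on₄ with
    | add x y hx hy => simp only [map_add, add_mul, hx, hy]
    | cons a b c d =>
      have e : onTail H (Q.comulHead H) (t ⊠ h ⊠ m) = ∑ j, t ⊠ Q.Δ1 h j ⊠ Q.Δ2 h j ⊠ m := by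
        rw [onTail_cons, comulHead_cons, cons_sum]
      simp only [e, Finset.mul_sum, map_sum, cons_mul_cons, twistFunα_cons]
      rw [← Finset.mul_sum, ← map_sum]
      simp only [← Finset.sum_mul]
      rw [sum_antipode_β, onTail_cons, trivHead_cons]
      simp [cons_smul]

theorem twist_mul_comul_α : Q.twist * Q.comul Q.α = Q.gam := by
  have h := congrArg (fun x ↦ Q.twistFunα (x * extendOne k H H Q.reassocInv)) Q.pentagon
  simp only [mul_assoc, ← map_mul, reassoc_mul_inv, map_one, mul_one] at h
  have e1 : onTail H (Q.trivHead H) Q.reassoc = 1 := by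
    have e : onTail H (Q.trivHead H) Q.reassoc
        = onTail H ((consOne k H _).comp (consOne k H H))
          (onTail H (Q.counitHead H) Q.reassoc) := by
      generalize Q.reassoc = t
      induction t using induction_on₂ with
      | add x y hx hy => simp only [map_add, hx, hy]
      | cons h m => rfl
    rw [e, onTail_counitHead_reassoc, map_one]
  have e2 : Q.trivHead _ Q.reassoc = 1 := by
    rw [trivHead, AlgHom.comp_apply, AlgHom.comp_apply, counitHead_reassoc, map_one, map_one]
  rw [twistFunα_mul_onTail_comulHead, e1, mul_one, twistFunα_onTail_comul_mul,
    onTail_onTail_counit_reassoc, one_mul, twistFunα_comulHead_mul, e2, one_mul] at h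
  have e3 : Q.twistFunα (extendOne k H H Q.reassocInv) = Q.twist * Q.comul Q.α := by
    rw [twist]
    generalize Q.reassocInv = t
    induction t using induction_on₃ with
    | add x y hx hy => simp only [map_add, add_mul, hx, hy]
    | cons a b c => simp [mul_assoc]
  have e4 : Q.twistFunα (consOne k H _ Q.reassoc) = Q.gam := by
    have e (t) : Q.twistFunα (consOne k H _ t) = Q.gam * Q.comul (Q.pairβα t) := by
      induction t using induction_on₃ with
      | add x y hx hy => simp only [map_add, mul_add, hx, hy]
      | cons a b c => simp [swapS_one]
    have e' : Q.pairβα Q.reassoc = 1 := by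
      simp [reassoc, Q.antipode₃]
    rw [e, e', map_one, mul_one]
  rw [← e3, ← h, e4]

/-- `a ⊗ b ⊗ c ⊗ d ⊗ e ↦ S(c)αd ⊗ aβS(b)αe` -/
def nestedβα : HTensor k H (HTensor k H (HTensor k H (HTensor k H H))) →ₗ[k] HTensor k H H :=
  (linMap LinearMap.id (sandwich LinearMap.id Q.α LinearMap.id)).comp
    ((contract Q.pairα).comp (rotate.comp (contract Q.pairβ)))

@[simp] theorem nestedβα_cons (a b c d e : H) : Q.nestedβα (a ⊠ b ⊠ c ⊠ d ⊠ e)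
    = (Q.S c * Q.α * d) ⊠ (a * Q.β * Q.S b * Q.α * e) := rfl

theorem nestedβα_onTail_comulHead_mul (u : HTensor k H (HTensor k H (HTensor k H H)))
    (w : HTensor k H (HTensor k H (HTensor k H (HTensor k H H)))) :
    Q.nestedβα (onTail H (onTail H (Q.comulHead H)) u * w)
      = Q.nestedβα (onTail H (onTail H (Q.trivHead H)) u * w) := by
  induction u using induction_on₄ with
  | add x y hx hy => simp only [map_add, add_mul, hx, hy]
  | cons t₁ t₂ h m =>
    induction w using induction_on₅ with
    | add x y hx hy => simp only [map_add, mul_add, hx, hy]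
    | cons a b c d e =>
      simp [trivHead_cons, cons_sum, cons_smul, Finset.sum_mul, ← sum_cons, sum_antipode_α,
        smul_cons]

theorem nestedβα_mul_comulHead
    (u : HTensor k H (HTensor k H (HTensor k H H)))
    (w : HTensor k H (HTensor k H (HTensor k H (HTensor k H H)))) :
    Q.nestedβα (w * Q.comulHead _ u) = Q.nestedβα (w * Q.trivHead _ u) := by
  induction u using induction_on₄ with
  | add x y hx hy => simp only [map_add, mul_add, hx, hy]
  | cons h m₁ m₂ m₃ =>
    induction w using induction_on₅ with
    | add x y hx hy => simp only [map_add, add_mul, hx, hy]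
    | cons a b c d e =>
      simp only [comulHead_cons, trivHead_cons, Finset.mul_sum, cons_mul_cons, map_sum,
        nestedβα_cons, mul_smul_comm, map_smul]
      rw [← cons_sum, ← Finset.sum_mul, ← Finset.sum_mul, sum_antipode_β]
      simp [cons_smul]

theorem onTail_comulHead_coassoc (t : HTensor k H (HTensor k H H)) :
    1 ⊠ extendOne k H H Q.reassoc
        * onTail H (Q.comulHead _) (onTail H (Q.comulHead H) t)
      = onTail H (onTail H (Q.comulHead H)) (onTail H (Q.comulHead H) t)
        * 1 ⊠ extendOne k H H Q.reassoc := by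
  induction t using induction_on₂ with
  | add x y hx hy => simp only [map_add, add_mul, mul_add, hx, hy]
  | cons h m =>
    simp only [onTail_cons, cons_mul_cons, one_mul, mul_one]
    rw [comulHead_coassoc]

theorem five_fold_cocycle :
    consOne k H _ Q.tensorA
        * onTail H (Q.comulHead _) (onTail H (onTail H Q.comul) Q.reassoc)
        * extendOne k H (HTensor k H H) Q.reassoc
      = onTail H (onTail H (Q.comulHead H))
          (onTail H (Q.comulHead H) Q.reassoc * extendOne k H H Q.reassoc)
        * Q.comulHead _ Q.tensorA := by
  have pent := congrArg (onTail H (Q.comulHead (HTensor k H H))) Q.pentagon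
  have pent' := congrArg (onTail H (onTail H (onTail H (headOnly k H H)))) Q.pentagon
  simp only [map_mul] at pent pent'
  have e1 : onTail H (onTail H (onTail H (headOnly k H H))) (consOne k H _ Q.reassoc)
      = 1 ⊠ extendOne k H H Q.reassoc := rfl
  have e2 : onTail H (onTail H (onTail H (headOnly k H H))) (onTail H (Q.comulHead H) Q.reassoc)
      = onTail H (Q.comulHead _) (extendOne k H H Q.reassoc) := by
    generalize Q.reassoc = t
    induction t using induction_on₃ with
    | add x y hx hy => simp only [map_add, hx, hy]
    | cons a b c => simp
  have e3 : onTail H (onTail H (onTail H (headOnly k H H))) (extendOne k H H Q.reassoc)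
      = extendOne k H (HTensor k H H) Q.reassoc := by
    generalize Q.reassoc = t
    induction t using induction_on₃ with
    | add x y hx hy => simp only [map_add, hx, hy]
    | cons a b c => rfl
  have e4 : onTail H (onTail H (onTail H (headOnly k H H)))
      (onTail H (onTail H Q.comul) Q.reassoc)
      = onTail H (onTail H (Q.comulHead H)) (extendOne k H H Q.reassoc) := by
    generalize Q.reassoc = t
    induction t using induction_on₃ with
    | add x y hx hy => simp only [map_add, hx, hy]
    | cons a b c => simp [comul_apply]
  have e5 : onTail H (onTail H (onTail H (headOnly k H H))) (Q.comulHead _ Q.reassoc)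
      = Q.comulHead _ (extendOne k H H Q.reassoc) := by
    generalize Q.reassoc = t
    induction t using induction_on₃ with
    | add x y hx hy => simp only [map_add, hx, hy]
    | cons a b c => simp
  have e6 : onTail H (Q.comulHead (HTensor k H H)) (consOne k H _ Q.reassoc)
      = consOne k H _ (Q.comulHead _ Q.reassoc) := rfl
  rw [e1, e2, e3, e4, e5] at pent'
  rw [e6] at pent
  have e7 : consOne k H _ Q.tensorA * consOne k H _ (Q.comulHead _ Q.reassoc)
      = 1 ⊠ extendOne k H H Q.reassoc := by
    rw [← map_mul, tensorA, mul_assoc, ← map_mul, reassocInv_mul, map_one, mul_one,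
      consOne_apply]
  have key : consOne k H _ Q.tensorA
        * onTail H (Q.comulHead _) (onTail H (onTail H Q.comul) Q.reassoc)
        * extendOne k H (HTensor k H H) Q.reassoc * Q.comulHead _ (Q.comulHead _ Q.reassoc)
      = onTail H (onTail H (Q.comulHead H))
          (onTail H (Q.comulHead H) Q.reassoc * extendOne k H H Q.reassoc)
        * Q.comulHead _ (extendOne k H H Q.reassoc) := by
    rw [mul_assoc, ← comulHead_coassoc, ← mul_assoc, mul_assoc (consOne k H _ Q.tensorA),
      ← pent, ← mul_assoc, ← mul_assoc, e7, onTail_comulHead_coassoc, mul_assoc, mul_assoc,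
      ← mul_assoc (1 ⊠ _), pent', map_mul, mul_assoc]
  rw [tensorA, map_mul (Q.comulHead _), ← tensorA, ← mul_assoc, ← key, mul_assoc _ _
    (Q.comulHead _ (Q.comulHead _ Q.reassocInv)), ← map_mul, ← map_mul, reassoc_mul_inv,
    map_one, map_one, mul_one]

theorem nestedβα_five_fold :
    Q.nestedβα (consOne k H _ Q.tensorA
        * onTail H (Q.comulHead _) (onTail H (onTail H Q.comul) Q.reassoc)
        * extendOne k H (HTensor k H H) Q.reassoc)
      = ∑ a, Q.qL1 a ⊠ Q.qL2 a := by
  have e1 : onTail H (onTail H (Q.trivHead H)) (extendOne k H H Q.reassoc) = 1 := by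
    rw [← Q.onTail_onTail_counit_reassoc (M := HTensor k H (HTensor k H H))]
    generalize Q.reassoc = t
    induction t using induction_on₃ with
    | add x y hx hy => simp only [map_add, hx, hy]
    | cons a b c =>
      simp [trivHead_cons, Algebra.ofId_apply, Algebra.algebraMap_eq_smul_one, one_def]
  have e2 : onTail H (onTail H (Q.trivHead H)) (onTail H (Q.comulHead H) Q.reassoc)
      = onTail H (onTail H ((consOne k H _).comp (consOne k H H))) Q.reassoc := by
    generalize Q.reassoc = t
    induction t using induction_on₂ with
    | add x y hx hy => simp only [map_add, hx, hy]
    | cons h m => rw [onTail_cons, onTail_cons, onTail_trivHead_comulHead, onTail_cons]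
  have e3 : Q.trivHead _ Q.tensorA = 1 ⊠ 1 ⊠ Q.reassocInv := by
    have h : Q.counitHead _ (extendOne k H H Q.reassoc)
        = onTail H (headOnly k H H) (Q.counitHead _ Q.reassoc) := by
      generalize Q.reassoc = t
      induction t using induction_on₃ with
      | add x y hx hy => simp only [map_add, hx, hy]
      | cons a b c => simp
    have h' : Q.counitHead _ Q.tensorA = Q.reassocInv := by
      rw [tensorA, map_mul, h, counitHead_reassoc, map_one, one_mul, counitHead_comulHead]
    rw [trivHead, AlgHom.comp_apply, AlgHom.comp_apply, h', consOne_apply, consOne_apply]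
  have e4 (a b c : H) : Q.nestedβα (onTail H (onTail H ((consOne k H _).comp (consOne k H H)))
        Q.reassoc * 1 ⊠ 1 ⊠ a ⊠ b ⊠ c) = (Q.S a * Q.α * b) ⊠ c := by
    conv_rhs => rw [← one_mul c, ← Q.antipode₃]
    simp [reassoc, Finset.sum_mul, cons_sum, mul_assoc]
  rw [five_fold_cocycle, nestedβα_mul_comulHead, nestedβα_onTail_comulHead_mul,
    map_mul (onTail H _), e1, e2, e3, mul_one, reassocInv]
  simp only [cons_sum, Finset.mul_sum, map_sum, e4]
  rfl

theorem tensorA_eq : Q.tensorA = ∑ t : Q.AIdx, Q.A1 t ⊠ Q.A2 t ⊠ Q.A3 t ⊠ Q.A4 t := by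
  simp only [tensorA, reassoc, reassocInv, map_sum, extendOne_cons, comulHead_cons]
  rw [Finset.sum_mul]
  simp [A1, A2, A3, A4, Fintype.sum_prod_type, Finset.mul_sum]

theorem gam_eq : Q.gam = ∑ t : Q.AIdx, Q.gam1 t ⊠ Q.gam2 t := by
  simp only [gam, tensorA_eq, map_sum]
  rfl

theorem twist_eq : Q.twist = ∑ c : Q.FIdx, Q.f1 c ⊠ Q.f2 c := by
  simp only [twist, reassocInv, map_sum, twistFun_cons, comul_apply, gam_eq, swapS_cons,
    mul_assoc, f1, f2]
  simp only [Finset.sum_mul_sum]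
  simp only [Finset.mul_sum, cons_mul_cons, Fintype.sum_prod_type]

/-- `a ⊗ b ↦ S(z)a ⊗ S(xβS(y)b)` -/
def leg (x y z : H) : HTensor k H H →ₗ[k] HTensor k H H :=
  linMap (LinearMap.mulLeft k (Q.S z)) (Q.S.comp (LinearMap.mulLeft k (x * Q.β * Q.S y)))

@[simp] theorem leg_cons (x y z a b : H) :
    Q.leg x y z (a ⊠ b) = (Q.S z * a) ⊠ Q.S (x * Q.β * Q.S y * b) := rfl

theorem leg_swapS_comul_mul_twist (x y z h : H) :
    Q.leg x y z (Q.swapS (Q.comul h) * Q.twist)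
      = ∑ c : Q.FIdx, ∑ j, (Q.S (Q.Δ2 h j * z) * Q.f1 c)
          ⊠ Q.S (x * Q.β * Q.S (Q.Δ1 h j * y) * Q.f2 c) := by
  simp only [comul_apply, twist_eq, map_sum, swapS_cons, Finset.sum_mul_sum, cons_mul_cons,
    leg_cons]
  rw [Finset.sum_comm]
  simp only [Q.S_mul, mul_assoc]

theorem swapS_comul_q2_mul_twist (i : Q.I) :
    Q.swapS (Q.comul (Q.q2 i)) * Q.twist
      = Q.nestedα (Q.tensorA * Q.comulHead _ (Q.X2 i ⊠ Q.comul (Q.X3 i))) := by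
  rw [← twist_mul_comul_S, q2, Q.S_mul, Q.S_Sinv, ← mul_assoc, map_mul, map_mul, ← mul_assoc,
    ← mul_assoc, twist_mul_comul_S, mul_assoc _ Q.twist, twist_mul_comul_α, gam,
    ← nestedα_mul_comulHead]

theorem leg_nestedα (u x y z : H) (w : HTensor k H (HTensor k H (HTensor k H H))) :
    Q.leg (u * x) y z (Q.nestedα w) = linMap LinearMap.id Q.S
      (Q.nestedβα (u ⊠ w * extendOne k H (HTensor k H H) (x ⊠ y ⊠ z))) := by
  induction w using induction_on₄ with
  | add x y hx hy => simp only [map_add, cons_add, add_mul, hx, hy]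
  | cons a b c d => simp [Q.S_mul, mul_assoc, one_def]

theorem sum_leg_twist :
    ∑ i, ∑ i₂, Q.leg (Q.q1 i * Q.X1 i₂) (Q.X2 i₂) (Q.X3 i₂)
        (Q.swapS (Q.comul (Q.q2 i)) * Q.twist)
      = ∑ a, Q.qL1 a ⊠ Q.S (Q.qL2 a) := by
  have e : consOne k H _ Q.tensorA
        * onTail H (Q.comulHead _) (onTail H (onTail H Q.comul) Q.reassoc)
      = ∑ i, Q.q1 i ⊠ (Q.tensorA * Q.comulHead _ (Q.X2 i ⊠ Q.comul (Q.X3 i))) := by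
    rw [reassoc, map_sum, map_sum, Finset.mul_sum]
    refine Finset.sum_congr rfl fun i _ ↦ ?_
    rw [onTail_cons, onTail_cons, onTail_cons, consOne_apply, cons_mul_cons, one_mul, q1]
  have h := congrArg (linMap LinearMap.id Q.S) Q.nestedβα_five_fold
  rw [e, reassoc] at h
  simp only [map_sum, Finset.sum_mul_sum, ← leg_nestedα, ← swapS_comul_q2_mul_twist,
    linMap_cons, LinearMap.id_apply] at h
  exact h

end QuasiHopf

/-- Lemma 4.1, identity (l5):
`∑ S(q²₂X³)f¹ ⊗ S(q¹X¹βS(q²₁X²)f²) = (id⊗S)(q_L)`,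
where `q_R = ∑ q¹⊗q² = ∑ X¹ ⊗ S⁻¹(αX³)X²` and `q_L = ∑ S(x¹)αx² ⊗ x³`. -/
theorem qR_twist_qL_identity {k H : Type} [Field k] [Ring H] [Algebra k H]
    (Q : QuasiHopf k H) :
    ∑ i, ∑ i2, ∑ c : Q.FIdx, ∑ j,
        (Q.S (Q.Δ2 (Q.q2 i) j * Q.X3 i2) * Q.f1 c)
          ⊗ₜ[k] Q.S (Q.q1 i * Q.X1 i2 * Q.β * Q.S (Q.Δ1 (Q.q2 i) j * Q.X2 i2) * Q.f2 c)
      = ∑ a, Q.qL1 a ⊗ₜ[k] Q.S (Q.qL2 a) := by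
  have h := Q.sum_leg_twist
  simp only [Q.leg_swapS_comul_mul_twist] at h
  exact h
end
end

section
/- Let H be a quasi-Hopf algebra over a field k. Define on the underlying vector space of H the multiplication h∘h' = ∑ X¹hS(x¹X²)αx²X³₁h'S(x³X³₂), the left H-action h▷h' = ∑ h₁h'S(h₂), and the left H-coaction λ(h) = ∑h_(-1)⊗h_(0) = ∑ X¹Y¹₁h₁g¹S(q²Y²₂)Y³ ⊗ X²Y¹₂h₂g²S(X³q¹Y²₁), where q_R = ∑q¹⊗q² = ∑X¹⊗S⁻¹(αX³)X² and f⁻¹ = ∑g¹⊗g² is the inverse Drinfeld twist. Then the algebra H₀ = (H,∘) is quantum commutative in the braided category of left Yetter–Drinfeld modules over H, that is, for all h,h'∈H: h∘h' = ∑ (h_(-1)▷h') ∘ h_(0). -/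
open scoped TensorProduct

noncomputable section

namespace QuasiHopf

variable {k H : Type} [Field k] [Ring H] [Algebra k H] (Q : QuasiHopf k H)

/-- The modified multiplication `h∘h' = ∑ X¹hS(x¹X²)αx²X³₁h'S(x³X³₂)` on `H₀`. -/
def circ (h h' : H) : H :=
  ∑ i, ∑ a, ∑ j,
    Q.X1 i * h * Q.S (Q.x1 a * Q.X2 i) * Q.α * Q.x2 a * Q.Δ1 (Q.X3 i) j * h'
      * Q.S (Q.x3 a * Q.Δ2 (Q.X3 i) j)

/-- The left adjoint action `h ▷ h' = ∑ h₁h'S(h₂)`. -/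
def tri (h h' : H) : H := ∑ j, Q.Δ1 h j * h' * Q.S (Q.Δ2 h j)

/-- index type for the components of the Yetter-Drinfeld coaction
`λ(h) = ∑ X¹Y¹₁h₁g¹S(q²Y²₂)Y³ ⊗ X²Y¹₂h₂g²S(X³q¹Y²₁)` of `H₀` -/
abbrev CIdx := Q.I × Q.I × Q.J × Q.J × Q.GIdx × Q.I × Q.J

/-- `h₍₋₁₎`, the `H`-components of the coaction of `H₀`:
`∑ X¹Y¹₁h₁g¹S(q²Y²₂)Y³`. -/
def cneg (h : H) (t : Q.CIdx) : H :=
  Q.X1 t.1 * Q.Δ1 (Q.X1 t.2.1) t.2.2.1 * Q.Δ1 h t.2.2.2.1 * Q.g1 t.2.2.2.2.1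
    * Q.S (Q.q2 t.2.2.2.2.2.1 * Q.Δ2 (Q.X2 t.2.1) t.2.2.2.2.2.2) * Q.X3 t.2.1

/-- `h₍₀₎`, the `H₀`-components of the coaction of `H₀`:
`∑ X²Y¹₂h₂g²S(X³q¹Y²₁)`. -/
def czero (h : H) (t : Q.CIdx) : H :=
  Q.X2 t.1 * Q.Δ2 (Q.X1 t.2.1) t.2.2.1 * Q.Δ2 h t.2.2.2.1 * Q.g2 t.2.2.2.2.1
    * Q.S (Q.X3 t.1 * Q.q1 t.2.2.2.2.2.1 * Q.Δ1 (Q.X2 t.2.1) t.2.2.2.2.2.2)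

end QuasiHopf

/-- A map is `k`-linear (unbundled). -/
@[fun_prop]
structure Lin (k : Type) {H : Type} [Field k] [Ring H] [Algebra k H] (f : H → H) : Prop where
  map_add : ∀ x y, f (x + y) = f x + f y
  map_smul : ∀ (c : k) x, f (c • x) = c • f x

namespace QuasiHopf

variable {k H : Type} [Field k] [Ring H] [Algebra k H] (Q : QuasiHopf k H)

/-- The contraction of `F` with `Δ(h)`. -/
def sumΔ (h : H) (F : H → H → H) : H := ∑ j, F (Q.Δ1 h j) (Q.Δ2 h j)

/-- The contraction of `F` with `Φ`. -/
def sumΦ (F : H → H → H → H) : H := ∑ i, F (Q.X1 i) (Q.X2 i) (Q.X3 i)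

/-- The contraction of `F` with `Φ⁻¹`. -/
def sumΨ (F : H → H → H → H) : H := ∑ a, F (Q.x1 a) (Q.x2 a) (Q.x3 a)

@[fun_prop]
theorem lin_id : Lin k fun x : H => x := ⟨fun _ _ => rfl, fun _ _ => rfl⟩

@[fun_prop]
theorem lin_comp {f g : H → H} (hf : Lin k f) (hg : Lin k g) : Lin k fun x => f (g x) :=
  ⟨fun _ _ => by rw [hg.map_add, hf.map_add],
   fun _ _ => by rw [hg.map_smul, hf.map_smul]⟩

@[fun_prop]
theorem lin_mul_right {f : H → H} (hf : Lin k f) (c : H) : Lin k fun x => f x * c :=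
  ⟨fun _ _ => by rw [hf.map_add, add_mul],
   fun _ _ => by rw [hf.map_smul, smul_mul_assoc]⟩

@[fun_prop]
theorem lin_mul_left {f : H → H} (hf : Lin k f) (c : H) : Lin k fun x => c * f x :=
  ⟨fun _ _ => by rw [hf.map_add, mul_add],
   fun _ _ => by rw [hf.map_smul, mul_smul_comm]⟩

@[fun_prop]
theorem lin_const_smul {f : H → H} (hf : Lin k f) (c : k) : Lin k fun x => c • f x :=
  ⟨fun _ _ => by rw [hf.map_add, smul_add],
   fun _ _ => by rw [hf.map_smul, smul_comm]⟩

@[fun_prop]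
theorem lin_ε_smul {f : H → H} (hf : Lin k f) (c : H) : Lin k fun x => Q.ε (f x) • c :=
  ⟨fun _ _ => by rw [hf.map_add, map_add, add_smul],
   fun _ _ => by rw [hf.map_smul, map_smul, smul_assoc]⟩

@[fun_prop]
theorem lin_S {f : H → H} (hf : Lin k f) : Lin k fun x => Q.S (f x) :=
  ⟨fun _ _ => by rw [hf.map_add, map_add],
   fun _ _ => by rw [hf.map_smul, map_smul]⟩

@[fun_prop]
theorem lin_sum {ι : Type} (s : Finset ι) {f : ι → H → H} (hf : ∀ i, Lin k (f i)) :
    Lin k fun x => ∑ i ∈ s, f i x :=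
  ⟨fun _ _ => by simp [(hf _).map_add, Finset.sum_add_distrib],
   fun _ _ => by simp [(hf _).map_smul, Finset.smul_sum]⟩

@[fun_prop]
theorem lin_sumΦ {F : H → H → H → H → H} (hF : ∀ a b c, Lin k fun x => F x a b c) :
    Lin k fun x => Q.sumΦ (F x) := lin_sum _ fun _ => hF _ _ _

@[fun_prop]
theorem lin_sumΨ {F : H → H → H → H → H} (hF : ∀ a b c, Lin k fun x => F x a b c) :
    Lin k fun x => Q.sumΨ (F x) := lin_sum _ fun _ => hF _ _ _

@[fun_prop]
theorem lin_sumΔ {F : H → H → H → H} (h : H) (hF : ∀ a b, Lin k fun x => F x a b) :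
    Lin k fun x => Q.sumΔ h (F x) := lin_sum _ fun _ => hF _ _

/-- The linear map on `H ⊗ H` induced by a bilinear function. -/
def lift2 (F : H → H → H) (h1 : ∀ b, Lin k fun a => F a b) (h2 : ∀ a, Lin k fun b => F a b) :
    H ⊗[k] H →ₗ[k] H :=
  TensorProduct.lift (LinearMap.mk₂ k F (fun a b c => (h1 c).map_add a b)
    (fun c a b => (h1 b).map_smul c a) (fun a => (h2 a).map_add) (fun c a => (h2 a).map_smul c))

@[simp]
theorem lift2_tmul (F : H → H → H) (h1 : ∀ b, Lin k fun a => F a b)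
    (h2 : ∀ a, Lin k fun b => F a b) (a b : H) : lift2 F h1 h2 (a ⊗ₜ b) = F a b := rfl

theorem lift2_Δmap (F : H → H → H) (h1 : ∀ b, Lin k fun a => F a b)
    (h2 : ∀ a, Lin k fun b => F a b) (h : H) : lift2 F h1 h2 (Q.Δmap h) = Q.sumΔ h F := by
  simp [Q.Δ_eq, sumΔ]

@[fun_prop]
theorem lin_sumΔ_arg {F : H → H → H} {f : H → H} (hf : Lin k f) (h1 : ∀ b, Lin k fun a => F a b)
    (h2 : ∀ a, Lin k fun b => F a b) : Lin k fun x => Q.sumΔ (f x) F :=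
  ⟨fun _ _ => by simp only [← Q.lift2_Δmap F h1 h2, hf.map_add, map_add],
   fun _ _ => by simp only [← Q.lift2_Δmap F h1 h2, hf.map_smul, map_smul]⟩

/-- The linear map on `H ⊗ (H ⊗ H)` induced by a trilinear function. -/
def lift3 (F : H → H → H → H) (h1 : ∀ b c, Lin k fun a => F a b c)
    (h2 : ∀ a c, Lin k fun b => F a b c) (h3 : ∀ a b, Lin k fun c => F a b c) :
    H ⊗[k] (H ⊗[k] H) →ₗ[k] H :=
  TensorProduct.lift
    { toFun := fun a => lift2 (F a) (h2 a) (h3 a)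
      map_add' := fun x y => TensorProduct.ext' fun b c => (h1 b c).map_add x y
      map_smul' := fun r x => TensorProduct.ext' fun b c => (h1 b c).map_smul r x }

@[simp]
theorem lift3_tmul (F : H → H → H → H) (h1 : ∀ b c, Lin k fun a => F a b c)
    (h2 : ∀ a c, Lin k fun b => F a b c) (h3 : ∀ a b, Lin k fun c => F a b c) (a b c : H) :
    lift3 F h1 h2 h3 (a ⊗ₜ (b ⊗ₜ c)) = F a b c := rfl

/-- The linear map on `H ⊗ (H ⊗ (H ⊗ H))` induced by a quadrilinear function. -/
def lift4 (F : H → H → H → H → H) (h1 : ∀ b c d, Lin k fun a => F a b c d)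
    (h2 : ∀ a c d, Lin k fun b => F a b c d) (h3 : ∀ a b d, Lin k fun c => F a b c d)
    (h4 : ∀ a b c, Lin k fun d => F a b c d) :
    H ⊗[k] (H ⊗[k] (H ⊗[k] H)) →ₗ[k] H :=
  TensorProduct.lift
    { toFun := fun a => lift3 (F a) (h2 a) (h3 a) (h4 a)
      map_add' := fun x y => TensorProduct.ext (LinearMap.ext fun b => TensorProduct.ext' fun c d =>
        (h1 b c d).map_add x y)
      map_smul' := fun r x => TensorProduct.ext (LinearMap.ext fun b =>
        TensorProduct.ext' fun c d => (h1 b c d).map_smul r x) }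

@[simp]
theorem lift4_tmul (F : H → H → H → H → H) (h1 : ∀ b c d, Lin k fun a => F a b c d)
    (h2 : ∀ a c d, Lin k fun b => F a b c d) (h3 : ∀ a b d, Lin k fun c => F a b c d)
    (h4 : ∀ a b c, Lin k fun d => F a b c d) (a b c d : H) :
    lift4 F h1 h2 h3 h4 (a ⊗ₜ (b ⊗ₜ (c ⊗ₜ d))) = F a b c d := rfl

/-- The reassociator as an element of `H ⊗ (H ⊗ H)`. -/
def Φ : H ⊗[k] (H ⊗[k] H) := ∑ i, Q.X1 i ⊗ₜ[k] (Q.X2 i ⊗ₜ[k] Q.X3 i)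

/-- The inverse reassociator as an element of `H ⊗ (H ⊗ H)`. -/
def Ψ : H ⊗[k] (H ⊗[k] H) := ∑ a, Q.x1 a ⊗ₜ[k] (Q.x2 a ⊗ₜ[k] Q.x3 a)

theorem Φ_mul_Ψ : Q.Φ * Q.Ψ = 1 := Q.Φ_right_inv

theorem Ψ_mul_Φ : Q.Ψ * Q.Φ = 1 := Q.Φ_left_inv

/-- `t ↦ 1 ⊗ t` -/
def e1 : H ⊗[k] (H ⊗[k] H) →ₐ[k] H ⊗[k] (H ⊗[k] (H ⊗[k] H)) :=
  Algebra.TensorProduct.includeRight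

/-- `id ⊗ Δ ⊗ id` -/
def e2 : H ⊗[k] (H ⊗[k] H) →ₐ[k] H ⊗[k] (H ⊗[k] (H ⊗[k] H)) :=
  Algebra.TensorProduct.map (AlgHom.id k H)
    ((Algebra.TensorProduct.assoc k k k H H H).toAlgHom.comp
      (Algebra.TensorProduct.map Q.Δmap (AlgHom.id k H)))

/-- `t ↦ t ⊗ 1` -/
def e3 : H ⊗[k] (H ⊗[k] H) →ₐ[k] H ⊗[k] (H ⊗[k] (H ⊗[k] H)) :=
  Algebra.TensorProduct.map (AlgHom.id k H)
    (Algebra.TensorProduct.map (AlgHom.id k H) Algebra.TensorProduct.includeLeft)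

/-- `id ⊗ id ⊗ Δ` -/
def e4 : H ⊗[k] (H ⊗[k] H) →ₐ[k] H ⊗[k] (H ⊗[k] (H ⊗[k] H)) :=
  Algebra.TensorProduct.map (AlgHom.id k H)
    (Algebra.TensorProduct.map (AlgHom.id k H) Q.Δmap)

/-- `Δ ⊗ id ⊗ id` -/
def e5 : H ⊗[k] (H ⊗[k] H) →ₐ[k] H ⊗[k] (H ⊗[k] (H ⊗[k] H)) :=
  (Algebra.TensorProduct.assoc k k k H H (H ⊗[k] H)).toAlgHom.comp
    (Algebra.TensorProduct.map Q.Δmap (AlgHom.id k (H ⊗[k] H)))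

@[simp]
theorem e1_tmul (a b c : H) :
    e1 (a ⊗ₜ[k] (b ⊗ₜ[k] c)) = 1 ⊗ₜ[k] (a ⊗ₜ[k] (b ⊗ₜ[k] c)) := rfl

@[simp]
theorem e3_tmul (a b c : H) :
    e3 (a ⊗ₜ[k] (b ⊗ₜ[k] c)) = a ⊗ₜ[k] (b ⊗ₜ[k] (c ⊗ₜ[k] 1)) := rfl

@[simp]
theorem e2_tmul (a b c : H) :
    Q.e2 (a ⊗ₜ[k] (b ⊗ₜ[k] c)) =
      ∑ j, a ⊗ₜ[k] (Q.Δ1 b j ⊗ₜ[k] (Q.Δ2 b j ⊗ₜ[k] c)) := by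
  simp [e2, Q.Δ_eq, TensorProduct.sum_tmul, TensorProduct.tmul_sum]

@[simp]
theorem e4_tmul (a b c : H) :
    Q.e4 (a ⊗ₜ[k] (b ⊗ₜ[k] c)) =
      ∑ j, a ⊗ₜ[k] (b ⊗ₜ[k] (Q.Δ1 c j ⊗ₜ[k] Q.Δ2 c j)) := by
  simp [e4, Q.Δ_eq, TensorProduct.tmul_sum]

@[simp]
theorem e5_tmul (a b c : H) :
    Q.e5 (a ⊗ₜ[k] (b ⊗ₜ[k] c)) =
      ∑ j, Q.Δ1 a j ⊗ₜ[k] (Q.Δ2 a j ⊗ₜ[k] (b ⊗ₜ[k] c)) := by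
  simp [e5, Q.Δ_eq, TensorProduct.sum_tmul]

theorem pentagon_s8 : e1 Q.Φ * Q.e2 Q.Φ * e3 Q.Φ = Q.e4 Q.Φ * Q.e5 Q.Φ := by
  simpa [Φ] using Q.cocycle

theorem map_Φ_mul_map_Ψ {A : Type} [Ring A] [Algebra k A] (e : H ⊗[k] (H ⊗[k] H) →ₐ[k] A) :
    e Q.Φ * e Q.Ψ = 1 := by
  rw [← map_mul, Q.Φ_mul_Ψ, map_one]

theorem map_Ψ_mul_map_Φ {A : Type} [Ring A] [Algebra k A] (e : H ⊗[k] (H ⊗[k] H) →ₐ[k] A) :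
    e Q.Ψ * e Q.Φ = 1 := by
  rw [← map_mul, Q.Ψ_mul_Φ, map_one]

set_option maxSynthPendingDepth 6 in
/-- `(Φ ⊗ 1) (Δ ⊗ id ⊗ id)(Φ⁻¹)`, rewritten by the pentagon equation. -/
theorem pentagon_left : e3 Q.Φ * Q.e5 Q.Ψ = Q.e2 Q.Ψ * (e1 Q.Ψ * Q.e4 Q.Φ) := by
  have h : e3 Q.Φ = Q.e2 Q.Ψ * (e1 Q.Ψ * (Q.e4 Q.Φ * Q.e5 Q.Φ)) := by
    rw [← pentagon_s8]
    simp only [mul_assoc, ← mul_assoc (e1 Q.Ψ), map_Ψ_mul_map_Φ, one_mul]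
    rw [← mul_assoc, map_Ψ_mul_map_Φ, one_mul]
  rw [h]
  simp only [mul_assoc, map_Φ_mul_map_Ψ, mul_one]

set_option maxSynthPendingDepth 6 in
/-- `(Δ ⊗ id ⊗ id)(Φ) (Φ⁻¹ ⊗ 1)`, rewritten by the pentagon equation. -/
theorem pentagon_right : Q.e5 Q.Φ * e3 Q.Ψ = Q.e4 Q.Ψ * (e1 Q.Φ * Q.e2 Q.Φ) := by
  have h : Q.e5 Q.Φ = Q.e4 Q.Ψ * (e1 Q.Φ * Q.e2 Q.Φ * e3 Q.Φ) := by
    rw [pentagon_s8, ← mul_assoc, map_Ψ_mul_map_Φ, one_mul]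
  rw [h]
  simp only [mul_assoc, map_Φ_mul_map_Ψ, mul_one]

set_option maxSynthPendingDepth 6 in
/-- `(id ⊗ id ⊗ Δ)(Φ⁻¹) (1 ⊗ Φ)`, rewritten by the pentagon equation. -/
theorem pentagon_mid : Q.e4 Q.Ψ * e1 Q.Φ = Q.e5 Q.Φ * (e3 Q.Ψ * Q.e2 Q.Ψ) := by
  rw [← mul_assoc, pentagon_right]
  simp only [mul_assoc, map_Φ_mul_map_Ψ, mul_one]

set_option maxSynthPendingDepth 6 in
theorem pentagon_left_apply (F : H → H → H → H → H)
    (h1 : ∀ b c d, Lin k fun a => F a b c d)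
    (h2 : ∀ a c d, Lin k fun b => F a b c d)
    (h3 : ∀ a b d, Lin k fun c => F a b c d)
    (h4 : ∀ a b c, Lin k fun d => F a b c d) :
    (Q.sumΨ fun x1 x2 x3 => Q.sumΔ x1 fun a b => Q.sumΦ fun X1 X2 X3 =>
      F (X1 * a) (X2 * b) (X3 * x2) x3) =
    Q.sumΦ fun X1 X2 X3 => Q.sumΔ X3 fun c d => Q.sumΨ fun y1 y2 y3 => Q.sumΨ fun x1 x2 x3 =>
      Q.sumΔ x2 fun a b => F (x1 * X1) (a * (y1 * X2)) (b * (y2 * c)) (x3 * (y3 * d)) := by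
  have h := congrArg (lift4 F h1 h2 h3 h4) Q.pentagon_left
  simp only [Φ, Ψ, map_sum, e1_tmul, e2_tmul, e3_tmul, e4_tmul, e5_tmul, Finset.sum_mul,
    Finset.mul_sum, Algebra.TensorProduct.tmul_mul_tmul, lift4_tmul, one_mul] at h
  exact h

set_option maxSynthPendingDepth 6 in
theorem pentagon_right_apply (F : H → H → H → H → H)
    (h1 : ∀ b c d, Lin k fun a => F a b c d)
    (h2 : ∀ a c d, Lin k fun b => F a b c d)
    (h3 : ∀ a b d, Lin k fun c => F a b c d)
    (h4 : ∀ a b c, Lin k fun d => F a b c d) :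
    (Q.sumΨ fun x1 x2 x3 => Q.sumΦ fun X1 X2 X3 => Q.sumΔ X1 fun a b =>
      F (a * x1) (b * x2) (X2 * x3) X3) =
    Q.sumΦ fun X1 X2 X3 => Q.sumΔ X2 fun a b => Q.sumΦ fun Y1 Y2 Y3 => Q.sumΨ fun x1 x2 x3 =>
      Q.sumΔ x3 fun c d => F (x1 * X1) (x2 * (Y1 * a)) (c * (Y2 * b)) (d * (Y3 * X3)) := by
  have h := congrArg (lift4 F h1 h2 h3 h4) Q.pentagon_right
  simp only [Φ, Ψ, map_sum, e1_tmul, e2_tmul, e3_tmul, e4_tmul, e5_tmul, Finset.sum_mul,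
    Finset.mul_sum, Algebra.TensorProduct.tmul_mul_tmul, lift4_tmul, one_mul, mul_one] at h
  exact h

set_option maxSynthPendingDepth 6 in
theorem pentagon_mid_apply (F : H → H → H → H → H)
    (h1 : ∀ b c d, Lin k fun a => F a b c d)
    (h2 : ∀ a c d, Lin k fun b => F a b c d)
    (h3 : ∀ a b d, Lin k fun c => F a b c d)
    (h4 : ∀ a b c, Lin k fun d => F a b c d) :
    (Q.sumΦ fun X1 X2 X3 => Q.sumΨ fun y1 y2 y3 => Q.sumΔ y3 fun c d =>
      F y1 (y2 * X1) (c * X2) (d * X3)) =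
    Q.sumΨ fun v1 v2 v3 => Q.sumΔ v2 fun c d => Q.sumΨ fun u1 u2 u3 => Q.sumΦ fun U1 U2 U3 =>
      Q.sumΔ U1 fun a b => F (a * (u1 * v1)) (b * (u2 * c)) (U2 * (u3 * d)) (U3 * v3) := by
  have h := congrArg (lift4 F h1 h2 h3 h4) Q.pentagon_mid
  simp only [Φ, Ψ, map_sum, e1_tmul, e2_tmul, e3_tmul, e4_tmul, e5_tmul, Finset.sum_mul,
    Finset.mul_sum, Algebra.TensorProduct.tmul_mul_tmul, lift4_tmul, one_mul, mul_one] at h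
  exact h

theorem _root_.Lin.map_sum {f : H → H} (hf : Lin k f) {ι : Type} (s : Finset ι) (g : ι → H) :
    f (∑ i ∈ s, g i) = ∑ i ∈ s, f (g i) := by
  let F : H →ₗ[k] H := ⟨⟨f, hf.map_add⟩, hf.map_smul⟩
  exact _root_.map_sum F g s

theorem map_sumΔ (f : H → H) (h : H) (F : H → H → H) (hf : Lin k f) :
    f (Q.sumΔ h F) = Q.sumΔ h fun a b => f (F a b) := hf.map_sum _ _

theorem map_sumΦ (f : H → H) (F : H → H → H → H) (hf : Lin k f) :
    f (Q.sumΦ F) = Q.sumΦ fun a b c => f (F a b c) := hf.map_sum _ _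

theorem map_sumΨ (f : H → H) (F : H → H → H → H) (hf : Lin k f) :
    f (Q.sumΨ F) = Q.sumΨ fun a b c => f (F a b c) := hf.map_sum _ _

theorem sumΔ_mul (h c : H) (F : H → H → H) :
    Q.sumΔ h F * c = Q.sumΔ h fun a b => F a b * c := Q.map_sumΔ (· * c) h F (by fun_prop)

theorem mul_sumΔ (h c : H) (F : H → H → H) :
    c * Q.sumΔ h F = Q.sumΔ h fun a b => c * F a b := Q.map_sumΔ (c * ·) h F (by fun_prop)

theorem smul_sumΔ (h : H) (c : k) (F : H → H → H) :
    c • Q.sumΔ h F = Q.sumΔ h fun a b => c • F a b := Q.map_sumΔ (c • ·) h F (by fun_prop)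

theorem sumΦ_mul (c : H) (F : H → H → H → H) :
    Q.sumΦ F * c = Q.sumΦ fun a b d => F a b d * c := Q.map_sumΦ (· * c) F (by fun_prop)

theorem mul_sumΦ (c : H) (F : H → H → H → H) :
    c * Q.sumΦ F = Q.sumΦ fun a b d => c * F a b d := Q.map_sumΦ (c * ·) F (by fun_prop)

theorem smul_sumΦ (c : k) (F : H → H → H → H) :
    c • Q.sumΦ F = Q.sumΦ fun a b d => c • F a b d := Q.map_sumΦ (c • ·) F (by fun_prop)

theorem sumΨ_mul (c : H) (F : H → H → H → H) :
    Q.sumΨ F * c = Q.sumΨ fun a b d => F a b d * c := Q.map_sumΨ (· * c) F (by fun_prop)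

theorem mul_sumΨ (c : H) (F : H → H → H → H) :
    c * Q.sumΨ F = Q.sumΨ fun a b d => c * F a b d := Q.map_sumΨ (c * ·) F (by fun_prop)

theorem smul_sumΨ (c : k) (F : H → H → H → H) :
    c • Q.sumΨ F = Q.sumΨ fun a b d => c • F a b d := Q.map_sumΨ (c • ·) F (by fun_prop)

theorem sumΔ_sumΔ_comm (h h' : H) (F : H → H → H → H → H) :
    (Q.sumΔ h fun a b => Q.sumΔ h' fun c d => F a b c d) =
      Q.sumΔ h' fun c d => Q.sumΔ h fun a b => F a b c d := Finset.sum_comm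

theorem sumΔ_sumΦ_comm (h : H) (F : H → H → H → H → H → H) :
    (Q.sumΔ h fun a b => Q.sumΦ fun X1 X2 X3 => F a b X1 X2 X3) =
      Q.sumΦ fun X1 X2 X3 => Q.sumΔ h fun a b => F a b X1 X2 X3 := Finset.sum_comm

theorem sumΔ_sumΨ_comm (h : H) (F : H → H → H → H → H → H) :
    (Q.sumΔ h fun a b => Q.sumΨ fun X1 X2 X3 => F a b X1 X2 X3) =
      Q.sumΨ fun X1 X2 X3 => Q.sumΔ h fun a b => F a b X1 X2 X3 := Finset.sum_comm

theorem sumΨ_sumΦ_comm (F : H → H → H → H → H → H → H) :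
    (Q.sumΨ fun a b c => Q.sumΦ fun X1 X2 X3 => F a b c X1 X2 X3) =
      Q.sumΦ fun X1 X2 X3 => Q.sumΨ fun a b c => F a b c X1 X2 X3 := Finset.sum_comm

theorem sumΦ_sumΦ_comm (F : H → H → H → H → H → H → H) :
    (Q.sumΦ fun a b c => Q.sumΦ fun X1 X2 X3 => F a b c X1 X2 X3) =
      Q.sumΦ fun X1 X2 X3 => Q.sumΦ fun a b c => F a b c X1 X2 X3 := Finset.sum_comm

theorem sumΔ_one (F : H → H → H) (h1 : ∀ b, Lin k fun a => F a b)
    (h2 : ∀ a, Lin k fun b => F a b) : Q.sumΔ 1 F = F 1 1 := by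
  rw [← Q.lift2_Δmap F h1 h2, map_one]
  rfl

theorem sumΔ_mul_arg (F : H → H → H) (g h : H) (h1 : ∀ b, Lin k fun a => F a b)
    (h2 : ∀ a, Lin k fun b => F a b) :
    Q.sumΔ (g * h) F = Q.sumΔ g fun a b => Q.sumΔ h fun c d => F (a * c) (b * d) := by
  rw [← Q.lift2_Δmap F h1 h2, map_mul]
  simp [Q.Δ_eq, Finset.sum_mul_sum, sumΔ]

theorem sumΔ_counit_left (f : H → H) (h : H) (hf : Lin k f) :
    (Q.sumΔ h fun a b => Q.ε a • f b) = f h := by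
  conv_rhs => rw [← Q.counit_left h, hf.map_sum]
  simp only [hf.map_smul, sumΔ]

theorem sumΔ_counit_right (f : H → H) (h : H) (hf : Lin k f) :
    (Q.sumΔ h fun a b => Q.ε b • f a) = f h := by
  conv_rhs => rw [← Q.counit_right h, hf.map_sum]
  simp only [hf.map_smul, sumΔ]

theorem sumΔ_antipode_left (f : H → H) (h : H) (hf : Lin k f) :
    (Q.sumΔ h fun a b => f (Q.S a * Q.α * b)) = Q.ε h • f Q.α := by
  rw [← Q.map_sumΔ f h (fun a b => Q.S a * Q.α * b) hf, ← hf.map_smul]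
  exact congrArg f (Q.antipode₁ h)

theorem sumΔ_antipode_right (f : H → H) (h : H) (hf : Lin k f) :
    (Q.sumΔ h fun a b => f (a * Q.β * Q.S b)) = Q.ε h • f Q.β := by
  rw [← Q.map_sumΔ f h (fun a b => a * Q.β * Q.S b) hf, ← hf.map_smul]
  exact congrArg f (Q.antipode₂ h)

theorem sumΦ_antipode (f : H → H) (hf : Lin k f) :
    (Q.sumΦ fun X1 X2 X3 => f (X1 * Q.β * Q.S X2 * Q.α * X3)) = f 1 := by
  rw [← Q.map_sumΦ f _ hf]
  exact congrArg f Q.antipode₃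

theorem sumΨ_antipode (f : H → H) (hf : Lin k f) :
    (Q.sumΨ fun x1 x2 x3 => f (Q.S x1 * Q.α * x2 * Q.β * Q.S x3)) = f 1 := by
  rw [← Q.map_sumΨ f _ hf]
  exact congrArg f Q.antipode₄

set_option maxSynthPendingDepth 6 in
theorem sumΦ_sumΨ_mul (F : H → H → H → H) (h1 : ∀ b c, Lin k fun a => F a b c)
    (h2 : ∀ a c, Lin k fun b => F a b c)
    (h3 : ∀ a b, Lin k fun c => F a b c) :
    (Q.sumΦ fun X1 X2 X3 => Q.sumΨ fun x1 x2 x3 => F (X1 * x1) (X2 * x2) (X3 * x3)) =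
      F 1 1 1 := by
  have h := congrArg (lift3 F h1 h2 h3) Q.Φ_mul_Ψ
  simp only [Φ, Ψ, Finset.sum_mul_sum, map_sum, Algebra.TensorProduct.tmul_mul_tmul, lift3_tmul] at h
  exact h

set_option maxSynthPendingDepth 6 in
theorem sumΨ_sumΦ_mul (F : H → H → H → H) (h1 : ∀ b c, Lin k fun a => F a b c)
    (h2 : ∀ a c, Lin k fun b => F a b c)
    (h3 : ∀ a b, Lin k fun c => F a b c) :
    (Q.sumΨ fun x1 x2 x3 => Q.sumΦ fun X1 X2 X3 => F (x1 * X1) (x2 * X2) (x3 * X3)) =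
      F 1 1 1 := by
  have h := congrArg (lift3 F h1 h2 h3) Q.Ψ_mul_Φ
  simp only [Φ, Ψ, Finset.sum_mul_sum, map_sum, Algebra.TensorProduct.tmul_mul_tmul, lift3_tmul] at h
  exact h

theorem sumΦ_counit_mid (F : H → H → H) (h1 : ∀ b, Lin k fun a => F a b)
    (h2 : ∀ a, Lin k fun b => F a b) :
    (Q.sumΦ fun X1 X2 X3 => Q.ε X2 • F X1 X3) = F 1 1 := by
  have h := congrArg (lift2 F h1 h2) Q.Φ_normal
  simp only [map_sum, map_smul, lift2_tmul] at h
  exact h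

set_option maxSynthPendingDepth 6 in
/-- Quasi-coassociativity in the form `Φ (Δ ⊗ id)Δ = (id ⊗ Δ)Δ Φ`. -/
theorem sumΦ_quasi_coassoc (F : H → H → H → H) (h : H)
    (h1 : ∀ b c, Lin k fun a => F a b c)
    (h2 : ∀ a c, Lin k fun b => F a b c)
    (h3 : ∀ a b, Lin k fun c => F a b c) :
    (Q.sumΔ h fun a b => Q.sumΔ a fun c d => Q.sumΦ fun X1 X2 X3 =>
      F (X1 * c) (X2 * d) (X3 * b)) =
    Q.sumΦ fun X1 X2 X3 => Q.sumΔ h fun a b => Q.sumΔ b fun c d =>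
      F (a * X1) (c * X2) (d * X3) := by
  have h := congrArg (fun t => lift3 F h1 h2 h3 (t * Q.Φ)) (Q.quasi_coassoc h)
  have e : (∑ a, Q.x1 a ⊗ₜ[k] (Q.x2 a ⊗ₜ[k] Q.x3 a)) * Q.Φ = 1 := Q.Φ_left_inv
  simp only [mul_assoc, e, mul_one] at h
  simp only [Φ, Finset.sum_mul, Finset.mul_sum, map_sum, Algebra.TensorProduct.tmul_mul_tmul,
    lift3_tmul] at h
  exact h.symm

set_option maxSynthPendingDepth 6 in
/-- Quasi-coassociativity in the form `(Δ ⊗ id)Δ Φ⁻¹ = Φ⁻¹ (id ⊗ Δ)Δ`. -/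
theorem sumΨ_quasi_coassoc (F : H → H → H → H) (h : H)
    (h1 : ∀ b c, Lin k fun a => F a b c)
    (h2 : ∀ a c, Lin k fun b => F a b c)
    (h3 : ∀ a b, Lin k fun c => F a b c) :
    (Q.sumΔ h fun a b => Q.sumΔ b fun c d => Q.sumΨ fun x1 x2 x3 =>
      F (x1 * a) (x2 * c) (x3 * d)) =
    Q.sumΨ fun x1 x2 x3 => Q.sumΔ h fun a b => Q.sumΔ a fun c d =>
      F (c * x1) (d * x2) (b * x3) := by
  have h := congrArg (fun t => lift3 F h1 h2 h3 (Q.Ψ * t)) (Q.quasi_coassoc h)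
  have e : Q.Ψ * (∑ i, Q.X1 i ⊗ₜ[k] (Q.X2 i ⊗ₜ[k] Q.X3 i)) = 1 := Q.Φ_left_inv
  simp only [← mul_assoc, e, one_mul] at h
  simp only [Ψ, Finset.sum_mul, Finset.mul_sum, map_sum, Algebra.TensorProduct.tmul_mul_tmul,
    lift3_tmul] at h
  exact h

theorem sumΔ_congr {h : H} {F G : H → H → H} (e : ∀ a b, F a b = G a b) :
    Q.sumΔ h F = Q.sumΔ h G := Finset.sum_congr rfl fun _ _ => e _ _

theorem sumΦ_congr {F G : H → H → H → H} (e : ∀ a b c, F a b c = G a b c) :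
    Q.sumΦ F = Q.sumΦ G := Finset.sum_congr rfl fun _ _ => e _ _ _

theorem sumΨ_congr {F G : H → H → H → H} (e : ∀ a b c, F a b c = G a b c) :
    Q.sumΨ F = Q.sumΨ G := Finset.sum_congr rfl fun _ _ => e _ _ _

theorem sumΨ_counit_mid (F : H → H → H) (h1 : ∀ b, Lin k fun a => F a b)
    (h2 : ∀ a, Lin k fun b => F a b) :
    (Q.sumΨ fun x1 x2 x3 => Q.ε x2 • F x1 x3) = F 1 1 := by
  have h := Q.sumΨ_sumΦ_mul (fun a b c => Q.ε b • F a c) (by fun_prop) (by fun_prop) (by fun_prop)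
  simp only [map_mul, mul_smul, map_one, one_smul, ← smul_sumΦ] at h
  simpa (disch := fun_prop) only [sumΦ_counit_mid, mul_one] using h

theorem sumΦ_counit_right (F : H → H → H) (h1 : ∀ b, Lin k fun a => F a b)
    (h2 : ∀ a, Lin k fun b => F a b) :
    (Q.sumΦ fun X1 X2 X3 => Q.ε X3 • F X1 X2) = F 1 1 := by
  have key (G : H → H → H → H) (h1 : ∀ b c, Lin k fun a => G a b c)
      (h2 : ∀ a c, Lin k fun b => G a b c) (h3 : ∀ a b, Lin k fun c => G a b c) :
      (Q.sumΦ fun X1 X2 X3 => Q.ε X3 • G X1 X2 1) = G 1 1 1 := by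
    have h := Q.pentagon_left_apply (fun a b c d => Q.ε c • G a b d)
      (by fun_prop) (by fun_prop) (by fun_prop) (by fun_prop)
    simp only [map_mul, mul_smul, sumΔ_sumΦ_comm, sumΨ_sumΦ_comm, ← smul_sumΔ, ← smul_sumΨ] at h
    simpa (disch := fun_prop) only [sumΔ_counit_right, sumΔ_one, ← smul_sumΨ, sumΨ_counit_mid,
      sumΔ_counit_left, mul_one, one_mul, ← sumΨ_sumΦ_comm, sumΨ_sumΦ_mul] using h
  simpa only [map_one, one_smul] using
    key (fun a b c => Q.ε c • F a b) (by fun_prop) (by fun_prop) (by fun_prop)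

theorem sumΦ_counit_left (F : H → H → H) (h1 : ∀ b, Lin k fun a => F a b)
    (h2 : ∀ a, Lin k fun b => F a b) :
    (Q.sumΦ fun X1 X2 X3 => Q.ε X1 • F X2 X3) = F 1 1 := by
  have key (G : H → H → H → H) (h1 : ∀ b c, Lin k fun a => G a b c)
      (h2 : ∀ a c, Lin k fun b => G a b c) (h3 : ∀ a b, Lin k fun c => G a b c) :
      (Q.sumΦ fun X1 X2 X3 => Q.ε X1 • G 1 X2 X3) = G 1 1 1 := by
    have h := Q.pentagon_mid_apply (fun a b c d => Q.ε b • G a c d)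
      (by fun_prop) (by fun_prop) (by fun_prop) (by fun_prop)
    simp only [map_mul, mul_smul, ← smul_sumΔ] at h
    simp (disch := fun_prop) only [sumΔ_counit_right, sumΔ_one, sumΨ_counit_mid, one_mul,
      ← smul_sumΦ] at h
    simp (disch := fun_prop) only [sumΔ_counit_left] at h
    simpa (disch := fun_prop) only [sumΨ_sumΦ_comm, sumΦ_sumΨ_mul] using h
  simpa only [map_one, one_smul] using
    key (fun a b c => Q.ε a • F b c) (by fun_prop) (by fun_prop) (by fun_prop)

theorem sumΨ_counit_right (F : H → H → H) (h1 : ∀ b, Lin k fun a => F a b)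
    (h2 : ∀ a, Lin k fun b => F a b) :
    (Q.sumΨ fun x1 x2 x3 => Q.ε x3 • F x1 x2) = F 1 1 := by
  have h := Q.sumΨ_sumΦ_mul (fun a b c => Q.ε c • F a b) (by fun_prop) (by fun_prop) (by fun_prop)
  simp only [map_mul, mul_smul, map_one, one_smul, ← smul_sumΦ] at h
  simpa (disch := fun_prop) only [sumΦ_counit_right, mul_one] using h

theorem sumΨ_shift_right (F : H → H → H) (l : H) (h1 : ∀ b, Lin k fun a => F a b)
    (h2 : ∀ a, Lin k fun b => F a b) :
    (Q.sumΨ fun x1 x2 x3 => Q.sumΔ l fun a b => Q.sumΔ a fun c d =>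
      F (c * x1) (d * x2 * Q.β * Q.S x3 * Q.S b)) =
    Q.sumΨ fun x1 x2 x3 => F (x1 * l) (x2 * Q.β * Q.S x3) := by
  have h := Q.sumΨ_quasi_coassoc (fun a b c => F a (b * Q.β * Q.S c)) l
    (by fun_prop) (by fun_prop) (by fun_prop)
  have e (a b : H) := Q.sumΔ_antipode_right
    (fun t => Q.sumΨ fun x1 x2 x3 => F (x1 * a) (x2 * t * Q.S x3)) b (by fun_prop)
  simp only [S_mul, mul_assoc] at h e ⊢
  rw [← h]
  simp (disch := fun_prop) only [e, sumΔ_counit_right]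

theorem sumΨ_shift_left (F : H → H → H) (n : H) (h1 : ∀ b, Lin k fun a => F a b)
    (h2 : ∀ a, Lin k fun b => F a b) :
    (Q.sumΨ fun u1 u2 u3 => F (Q.S u1 * Q.α * u2) (n * u3)) =
    Q.sumΔ n fun a b => Q.sumΔ b fun c d => Q.sumΨ fun u1 u2 u3 =>
      F (Q.S a * Q.S u1 * Q.α * u2 * c) (u3 * d) := by
  have h := Q.sumΨ_quasi_coassoc (fun a b c => F (Q.S a * Q.α * b) c) n
    (by fun_prop) (by fun_prop) (by fun_prop)
  have e (a b u1 u2 u3 : H) := Q.sumΔ_antipode_left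
    (fun t => F (Q.S u1 * t * u2) (b * u3)) a (by fun_prop)
  simp only [S_mul, mul_assoc] at h e ⊢
  rw [h]
  simp (disch := fun_prop) only [e, sumΔ_counit_left]

theorem pentagon_left_contract (F : H → H → H → H) (h1 : ∀ b c, Lin k fun a => F a b c)
    (h2 : ∀ a c, Lin k fun b => F a b c) (h3 : ∀ a b, Lin k fun c => F a b c) :
    (Q.sumΨ fun x1 x2 x3 => Q.sumΔ x1 fun a b => Q.sumΦ fun X1 X2 X3 =>
      F (X1 * a) (Q.S b * Q.S X2 * Q.α * X3 * x2) x3) =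
    Q.sumΦ fun X1 X2 X3 => Q.sumΔ X3 fun c d => Q.sumΨ fun y1 y2 y3 =>
      F X1 (Q.S X2 * Q.S y1 * Q.α * y2 * c) (y3 * d) := by
  have h := Q.pentagon_left_apply (fun a b c d => F a (Q.S b * Q.α * c) d)
      (by fun_prop) (by fun_prop) (by fun_prop) (by fun_prop)
  have e (A C D y1 y2 X2 x2 : H) := Q.sumΔ_antipode_left
    (fun t => F A (Q.S X2 * Q.S y1 * t * y2 * C) D) x2 (by fun_prop)
  simp only [S_mul, mul_assoc] at h e ⊢
  rw [h]
  simp (disch := fun_prop) only [e, sumΨ_counit_mid, one_mul]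

theorem pentagon_right_contract (F : H → H → H) (h1 : ∀ b, Lin k fun a => F a b)
    (h2 : ∀ a, Lin k fun b => F a b) :
    (Q.sumΨ fun x1 x2 x3 => Q.sumΦ fun X1 X2 X3 => Q.sumΔ X1 fun a b =>
      F (a * x1) (b * x2 * Q.β * Q.S x3 * Q.S X2 * Q.α * X3)) = F 1 1 := by
  have h := Q.pentagon_right_apply (fun a b c d => F a (b * Q.β * Q.S c * Q.α * d))
      (by fun_prop) (by fun_prop) (by fun_prop) (by fun_prop)
  have e (A p q a b Z r s : H) := Q.sumΔ_antipode_left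
    (fun t => F A (p * q * a * Q.β * Q.S b * Q.S Z * t * r)) s (by fun_prop)
  have e2 (A p q s : H) := Q.sumΔ_antipode_right (fun t => F A (p * t * q)) s (by fun_prop)
  have e3 (A : H) := Q.sumΦ_antipode (fun t => F A t) (by fun_prop)
  simp only [S_mul, mul_assoc] at h e e2 e3 ⊢
  rw [h]
  simp (disch := fun_prop) only [e, sumΨ_counit_right, one_mul, sumΔ_sumΦ_comm]
  simp (disch := fun_prop) only [e2]
  rw [sumΦ_sumΦ_comm]
  simp (disch := fun_prop) only [sumΦ_counit_mid, mul_one, e3]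

theorem pentagon_mid_contract (F : H → H → H → H) (h1 : ∀ b c, Lin k fun a => F a b c)
    (h2 : ∀ a c, Lin k fun b => F a b c) (h3 : ∀ a b, Lin k fun c => F a b c) :
    (Q.sumΦ fun X1 X2 X3 => Q.sumΨ fun y1 y2 y3 => Q.sumΔ y3 fun c d =>
      F (Q.S y1 * Q.α * y2 * X1) (c * X2) (d * X3)) =
    Q.sumΨ fun v1 v2 v3 => Q.sumΔ v2 fun c d => Q.sumΨ fun u1 u2 u3 =>
      F (Q.S v1 * Q.S u1 * Q.α * u2 * c) (u3 * d) v3 := by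
  have h := Q.pentagon_mid_apply (fun a b c d => F (Q.S a * Q.α * b) c d)
      (by fun_prop) (by fun_prop) (by fun_prop) (by fun_prop)
  have e (A B p r q s : H) := Q.sumΔ_antipode_left
    (fun t => F (p * r * t * q) A B) s (by fun_prop)
  simp only [S_mul, mul_assoc] at h e ⊢
  rw [h]
  simp (disch := fun_prop) only [e, sumΦ_counit_left, one_mul]

/-- `P a = ∑ X¹ a S(X²) α X³` -/
def proj (a : H) : H := Q.sumΦ fun X1 X2 X3 => X1 * a * Q.S X2 * Q.α * X3

theorem tri_eq (h a : H) : Q.tri h a = Q.sumΔ h fun c d => c * a * Q.S d := rfl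

theorem circ_eq (h h' : H) : Q.circ h h' = Q.sumΦ fun X1 X2 X3 => Q.sumΨ fun x1 x2 x3 =>
    Q.sumΔ X3 fun a b => X1 * h * Q.S (x1 * X2) * Q.α * x2 * a * h' * Q.S (x3 * b) := rfl

@[fun_prop]
theorem lin_proj {f : H → H} (hf : Lin k f) : Lin k fun x => Q.proj (f x) := by
  unfold proj
  fun_prop

@[fun_prop]
theorem lin_tri {f : H → H} (hf : Lin k f) (a : H) : Lin k fun x => Q.tri (f x) a := by
  simp only [tri_eq]
  fun_prop

theorem tri_mul (g h a : H) : Q.tri (g * h) a = Q.tri g (Q.tri h a) := by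
  simp only [tri_eq]
  rw [sumΔ_mul_arg _ _ _ _ (by fun_prop) (by fun_prop)]
  simp only [S_mul, mul_assoc, mul_sumΔ, sumΔ_mul]

theorem circ_eq_proj (a b : H) :
    Q.circ a b = Q.sumΨ fun x1 x2 x3 => Q.proj (Q.tri x1 a) * x2 * b * Q.S x3 := by
  have h := Q.pentagon_left_contract (fun p q r => p * a * q * b * Q.S r)
    (by fun_prop) (by fun_prop) (by fun_prop)
  simp only [circ_eq, proj, tri_eq, S_mul, mul_sumΔ, sumΔ_mul, sumΦ_mul, mul_assoc,
    sumΔ_sumΦ_comm, sumΔ_sumΨ_comm] at h ⊢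
  rw [h]

theorem proj_tri (a : H) :
    (Q.sumΨ fun x1 x2 x3 => Q.proj (Q.tri x1 a) * x2 * Q.β * Q.S x3) = a := by
  have h := Q.pentagon_left_contract (fun p q r => p * a * q * Q.β * Q.S r)
    (by fun_prop) (by fun_prop) (by fun_prop)
  have e (X1 X2 y1 y2 y3 s : H) := Q.sumΔ_antipode_right
    (fun t => X1 * a * Q.S X2 * Q.S y1 * Q.α * y2 * t * Q.S y3) s (by fun_prop)
  have e2 := Q.sumΨ_antipode (fun t => a * t) (by fun_prop)
  simp only [proj, tri_eq, S_mul, mul_sumΔ, sumΔ_mul, sumΦ_mul, mul_assoc,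
    sumΔ_sumΦ_comm, sumΔ_sumΨ_comm] at h e e2 ⊢
  rw [h]
  simp (disch := fun_prop) only [e, ← smul_sumΨ, sumΦ_counit_right, S_one, one_mul, e2, mul_one]

theorem proj_tri_mul (l a : H) :
    (Q.sumΔ l fun b c => Q.proj (Q.tri b a) * c) = l * Q.proj a := by
  have h := Q.sumΦ_quasi_coassoc (fun p q r => p * a * Q.S q * Q.α * r) l
    (by fun_prop) (by fun_prop) (by fun_prop)
  have e (p X1 X2 X3 s : H) := Q.sumΔ_antipode_left
    (fun t => p * X1 * a * Q.S X2 * t * X3) s (by fun_prop)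
  simp only [proj, tri_eq, S_mul, mul_sumΔ, sumΔ_mul, sumΦ_mul, mul_sumΦ, mul_assoc,
    sumΔ_sumΦ_comm] at h e ⊢
  rw [h]
  simp (disch := fun_prop) only [e, sumΔ_counit_right]

/-- The contraction of `F` with `Δ(m) p_R`, where `p_R = ∑ x¹ ⊗ x²βS(x³)`. -/
def sumPR (m : H) (F : H → H → H) : H :=
  Q.sumΔ m fun a b => Q.sumΨ fun x1 x2 x3 => F (a * x1) (b * x2 * Q.β * Q.S x3)

@[fun_prop]
theorem lin_sumPR {F : H → H → H → H} (m : H) (hF : ∀ a b, Lin k fun x => F x a b) :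
    Lin k fun x => Q.sumPR m (F x) := by
  unfold sumPR
  fun_prop

@[fun_prop]
theorem lin_sumPR_arg {F : H → H → H} {f : H → H} (hf : Lin k f)
    (h1 : ∀ b, Lin k fun a => F a b) (h2 : ∀ a, Lin k fun b => F a b) :
    Lin k fun x => Q.sumPR (f x) F := by
  unfold sumPR
  fun_prop

theorem sumPR_mul (g m : H) (F : H → H → H) (h1 : ∀ b, Lin k fun a => F a b)
    (h2 : ∀ a, Lin k fun b => F a b) :
    Q.sumPR (g * m) F = Q.sumΔ g fun a b => Q.sumPR m fun c d => F (a * c) (b * d) := by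
  unfold sumPR
  rw [sumΔ_mul_arg _ _ _ _ (by fun_prop) (by fun_prop)]
  simp only [mul_assoc]

theorem sumPR_shift (m l : H) (F : H → H → H) (h1 : ∀ b, Lin k fun a => F a b)
    (h2 : ∀ a, Lin k fun b => F a b) :
    (Q.sumΔ l fun a b => Q.sumPR (m * a) fun p q => F p (q * Q.S b)) =
      Q.sumPR m fun p q => F (p * l) q := by
  have e (p q : H) := Q.sumΨ_shift_right (fun r s => F (p * r) (q * s)) l
    (by fun_prop) (by fun_prop)
  have c (a b : H) := Q.sumPR_mul m a (fun p q => F p (q * Q.S b)) (by fun_prop) (by fun_prop)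
  simp only [c]
  rw [sumΔ_sumΔ_comm]
  simp only [sumPR, mul_assoc, sumΔ_sumΨ_comm] at e ⊢
  simp only [← sumΔ_sumΨ_comm, e]

/-- The contraction of `F` with the inverse Drinfeld twist. -/
def sumG (F : H → H → H) : H := ∑ t, F (Q.g1 t) (Q.g2 t)

theorem sumG_unfold (F : H → H → H) :
    Q.sumG F = Q.sumΨ fun y1 y2 y3 => Q.sumΔ (Q.S y1 * Q.α * y2) fun m n =>
      Q.sumΦ fun X1 X2 X3 => Q.sumΔ X1 fun a b => Q.sumΨ fun x1 x2 x3 => Q.sumΔ y3 fun c d =>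
        F (m * (a * x1 * Q.β * Q.S X3) * Q.S d) (n * (b * x2 * Q.β * Q.S (X2 * x3)) * Q.S c) := by
  simp only [sumG, Fintype.sum_prod_type]
  rfl

theorem sumG_eq (F : H → H → H) (h1 : ∀ b, Lin k fun a => F a b)
    (h2 : ∀ a, Lin k fun b => F a b) :
    Q.sumG F = Q.sumΨ fun v1 v2 v3 => Q.sumΨ fun u1 u2 u3 =>
      Q.sumPR (Q.S v1 * Q.S u1 * Q.α * u2) fun p q =>
        F (p * v2 * Q.β * Q.S v3) (q * Q.S u3) := by
  have h := Q.pentagon_mid_contract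
    (fun p r s => Q.sumPR p fun m n => F (m * Q.β * Q.S s) (n * Q.S r))
    (by fun_prop) (by fun_prop) (by fun_prop)
  have e (v1 v2 v3 u1 u2 u3 : H) := Q.sumPR_shift (Q.S v1 * Q.S u1 * Q.α * u2) v2
    (fun p q => F (p * Q.β * Q.S v3) (q * Q.S u3))
    (by fun_prop) (by fun_prop)
  have e2 (X1 X2 X3 y1 y2 c d : H) := Q.sumPR_mul (Q.S y1 * Q.α * y2) X1
    (fun m n => F (m * Q.β * Q.S (d * X3)) (n * Q.S (c * X2))) (by fun_prop) (by fun_prop)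
  simp only [S_mul, mul_assoc, sumΔ_sumΨ_comm] at h e e2 ⊢
  simp only [e, e2] at h
  rw [← h]
  simp only [sumG_unfold, sumPR, S_mul, mul_assoc, sumΔ_sumΨ_comm, sumΔ_sumΦ_comm, sumΨ_sumΦ_comm]
  refine Q.sumΦ_congr fun X1 X2 X3 => Q.sumΨ_congr fun y1 y2 y3 => Q.sumΨ_congr fun x1 x2 x3 => ?_
  rw [sumΔ_sumΔ_comm _ y3]
  refine Q.sumΔ_congr fun m n => ?_
  rw [sumΔ_sumΔ_comm]

/-- The contraction of `F` with the coaction of `h`, up to a factor `Φ`. -/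
def sumCoact (h : H) (F : H → H → H) : H :=
  Q.sumΦ fun Y1 Y2 Y3 => Q.sumΔ Y1 fun a b => Q.sumΔ h fun h1 h2 =>
    Q.sumG fun g1 g2 => Q.sumΦ fun Z1 Z2 Z3 => Q.sumΔ Y2 fun c d =>
      F (a * h1 * g1 * Q.S d * Q.S Z2 * Q.α * Z3 * Y3) (b * h2 * g2 * Q.S c * Q.S Z1)

theorem sumCoact_eq (h : H) (F : H → H → H) (h1 : ∀ b, Lin k fun a => F a b)
    (h2 : ∀ a, Lin k fun b => F a b) :
    Q.sumCoact h F = Q.sumΦ fun X1 X2 X3 => Q.sumΨ fun y1 y2 y3 =>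
      Q.sumPR (X1 * h * Q.S X2 * Q.S y1 * Q.α * y2) fun p q => F (p * X3) (q * Q.S y3) := by
  have e0 (Y1 Y3 Z1 Z2 Z3 c d v1 v2 v3 u1 u2 u3 : H) := Q.sumPR_mul Y1
    (h * Q.S v1 * Q.S u1 * Q.α * u2)
    (fun p q => F (p * v2 * Q.β * Q.S v3 * Q.S d * Q.S Z2 * Q.α * Z3 * Y3) (q * Q.S u3 * Q.S c * Q.S Z1))
    (by fun_prop) (by fun_prop)
  have e1 (Y3 a b Z1 Z2 Z3 c d v1 v2 v3 u1 u2 u3 : H) := Q.sumPR_mul h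
    (Q.S v1 * Q.S u1 * Q.α * u2)
    (fun p q => F (a * p * v2 * Q.β * Q.S v3 * Q.S d * Q.S Z2 * Q.α * Z3 * Y3) (b * q * Q.S u3 * Q.S c * Q.S Z1))
    (by fun_prop) (by fun_prop)
  have s0 : Q.sumCoact h F = Q.sumΦ fun Y1 Y2 Y3 => Q.sumΦ fun Z1 Z2 Z3 => Q.sumΔ Y2 fun c d =>
      Q.sumΨ fun v1 v2 v3 => Q.sumΨ fun u1 u2 u3 =>
        Q.sumPR (Y1 * (h * Q.S v1 * Q.S u1 * Q.α * u2)) fun p q =>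
          F (p * v2 * Q.β * Q.S v3 * Q.S d * Q.S Z2 * Q.α * Z3 * Y3)
            (q * Q.S u3 * Q.S c * Q.S Z1) := by
    unfold sumCoact
    simp (disch := fun_prop) only [sumG_eq]
    simp only [mul_assoc] at e0 e1 ⊢
    simp only [e0, e1]
    simp only [sumPR, sumΔ_sumΨ_comm, sumΔ_sumΦ_comm, sumΨ_sumΦ_comm]
    refine Q.sumΦ_congr fun Y1 Y2 Y3 => Q.sumΦ_congr fun Z1 Z2 Z3 => Q.sumΨ_congr fun v1 v2 v3 =>
      Q.sumΨ_congr fun u1 u2 u3 => Q.sumΨ_congr fun x1 x2 x3 => ?_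
    rw [sumΔ_sumΔ_comm _ Y2]
    refine Q.sumΔ_congr fun a b => ?_
    rw [sumΔ_sumΔ_comm _ Y2]
    refine Q.sumΔ_congr fun c d => ?_
    rw [sumΔ_sumΔ_comm _ Y2]
  have e2 (Y1 Y3 Z1 Z2 Z3 c d v1 v2 v3 : H) := Q.sumΨ_shift_left
    (fun s t => Q.sumPR (Y1 * h * Q.S v1 * s) fun p q =>
      F (p * v2 * Q.β * Q.S v3 * Q.S d * Q.S Z2 * Q.α * Z3 * Y3) (q * Q.S t))
    (Z1 * c) (by fun_prop) (by fun_prop)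
  have e3 (Y1 Y3 Z2 Z3 d v1 v2 v3 u1 u2 u3 a b : H) := Q.sumPR_shift
    (Y1 * h * Q.S v1 * Q.S a * Q.S u1 * Q.α * u2) b
    (fun p q => F (p * v2 * Q.β * Q.S v3 * Q.S d * Q.S Z2 * Q.α * Z3 * Y3) (q * Q.S u3))
    (by fun_prop) (by fun_prop)
  let G (Y1 Y3 s r : H) : H := Q.sumΨ fun u1 u2 u3 =>
    Q.sumPR (Y1 * h * Q.S s * Q.S u1 * Q.α * u2) fun p q => F (p * r * Y3) (q * Q.S u3)
  have G1 (Y1 Y3 r : H) : Lin k fun s => G Y1 Y3 s r := by fun_prop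
  have G2 (Y1 Y3 s : H) : Lin k fun r => G Y1 Y3 s r := by fun_prop
  have s1 : Q.sumCoact h F = Q.sumΦ fun Y1 Y2 Y3 => Q.sumΦ fun Z1 Z2 Z3 => Q.sumΔ Y2 fun c d =>
      Q.sumΨ fun v1 v2 v3 => Q.sumΔ (Z1 * c) fun m n =>
        G Y1 Y3 (m * v1) (n * v2 * Q.β * Q.S v3 * Q.S d * Q.S Z2 * Q.α * Z3) := by
    rw [s0]
    simp only [S_mul, mul_assoc, G] at e2 e3 ⊢
    simp only [sumΔ_sumΨ_comm] at e2
    simp only [e2, e3]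
    simp only [sumΔ_sumΨ_comm]
  have e4 (Y1 Y3 Z1 Z2 Z3 c d v1 v2 v3 : H) := Q.sumΔ_mul_arg
    (fun m n => G Y1 Y3 (m * v1) (n * v2 * Q.β * Q.S v3 * Q.S d * Q.S Z2 * Q.α * Z3)) Z1 c
    (by fun_prop) (by fun_prop)
  have e5 (Y1 Y2 Y3 Z2 Z3 a b : H) := Q.sumΨ_shift_right
    (fun m n => G Y1 Y3 (a * m) (b * n * Q.S Z2 * Q.α * Z3)) Y2 (by fun_prop) (by fun_prop)
  have e6 (Y1 Y2 Y3 : H) := Q.pentagon_right_contract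
    (fun m n => G Y1 Y3 (m * Y2) n) (by fun_prop) (by fun_prop)
  have s2 : Q.sumCoact h F = Q.sumΦ fun Y1 Y2 Y3 => G Y1 Y3 Y2 1 := by
    rw [s1]
    refine Q.sumΦ_congr fun Y1 Y2 Y3 => ?_
    simp only [mul_assoc, sumΔ_sumΨ_comm, sumΨ_sumΦ_comm, one_mul] at e4 e5 e6 ⊢
    rw [← e6]
    refine Q.sumΦ_congr fun Z1 Z2 Z3 => ?_
    simp only [e4, Q.sumΔ_sumΔ_comm Y2 Z1]
    rw [← sumΔ_sumΨ_comm, ← sumΔ_sumΨ_comm]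
    simp only [e5]
  rw [s2]
  simp only [G, mul_one]

theorem sum_coaction_eq_sumCoact (h : H) (F : H → H → H) (h1 : ∀ b, Lin k fun a => F a b)
    (h2 : ∀ a, Lin k fun b => F a b) :
    (∑ t : Q.CIdx, Q.sumΨ fun x1 x2 x3 =>
      F (x1 * Q.cneg h t) (x2 * Q.czero h t * Q.S x3)) = Q.sumCoact h F := by
  have c (A B C : H) : (Q.sumΦ fun X1 X2 X3 => Q.sumΨ fun x1 x2 x3 =>
      F (x1 * (X1 * A)) (x2 * (X2 * B * Q.S (X3 * C)) * Q.S x3)) = F A (B * Q.S C) := by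
    have e := Q.sumΨ_sumΦ_mul (fun p q r => F (p * A) (q * B * Q.S (r * C)))
      (by fun_prop) (by fun_prop) (by fun_prop)
    simp only [S_mul, mul_assoc, one_mul, sumΨ_sumΦ_comm] at e ⊢
    exact e
  rw [Fintype.sum_prod_type, Finset.sum_comm]
  have d (t : Q.I × Q.J × Q.J × Q.GIdx × Q.I × Q.J) := c
    (Q.Δ1 (Q.X1 t.1) t.2.1 * Q.Δ1 h t.2.2.1 * Q.g1 t.2.2.2.1
      * Q.S (Q.q2 t.2.2.2.2.1 * Q.Δ2 (Q.X2 t.1) t.2.2.2.2.2) * Q.X3 t.1)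
    (Q.Δ2 (Q.X1 t.1) t.2.1 * Q.Δ2 h t.2.2.1 * Q.g2 t.2.2.2.1)
    (Q.q1 t.2.2.2.2.1 * Q.Δ1 (Q.X2 t.1) t.2.2.2.2.2)
  simp only [cneg, czero, sumΦ, mul_assoc] at d ⊢
  simp only [d]
  rw [Fintype.sum_prod_type]
  refine Finset.sum_congr rfl fun Y _ => ?_
  rw [Fintype.sum_prod_type]
  refine Finset.sum_congr rfl fun i _ => ?_
  rw [Fintype.sum_prod_type]
  refine Finset.sum_congr rfl fun j _ => ?_
  rw [Fintype.sum_prod_type]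
  refine Finset.sum_congr rfl fun g _ => ?_
  rw [Fintype.sum_prod_type]
  simp only [q1, q2, sumΦ, sumΔ, S_mul, S_Sinv, mul_assoc]

theorem sumPR_proj_tri (m l s h' : H) :
    (Q.sumPR m fun p q => Q.proj (Q.tri (p * l) h') * (q * s)) = m * Q.tri l h' * s := by
  have e (x1 x2 x3 : H) := Q.proj_tri_mul m (Q.tri (x1 * l) h')
  have e2 := Q.proj_tri (Q.tri l h')
  have e3 (x1 x2 x3 : H) := congrArg (· * (x2 * Q.β * Q.S x3 * s)) (e x1 x2 x3)
  unfold sumPR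
  rw [sumΔ_sumΨ_comm]
  beta_reduce
  nth_rw 1 [← e2]
  simp only [tri_mul, mul_assoc, sumΔ_mul, sumΨ_mul, mul_sumΨ] at e3 ⊢
  simp only [e3]

end QuasiHopf

/-- Proposition 4.2: the algebra `H₀` is quantum commutative in the braided
category of left Yetter-Drinfeld modules over `H`, i.e.
`h∘h' = ∑ (h₍₋₁₎ ▷ h') ∘ h₍₀₎` for all `h, h' ∈ H`. -/
theorem H0_quantum_commutative {k H : Type} [Field k] [Ring H] [Algebra k H]
    (Q : QuasiHopf k H) (h h' : H) :
    Q.circ h h' = ∑ t : Q.CIdx, Q.circ (Q.tri (Q.cneg h t) h') (Q.czero h t) := by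
  have e := Q.sum_coaction_eq_sumCoact h (fun a b => Q.proj (Q.tri a h') * b)
    (by fun_prop) (by fun_prop)
  have e2 := Q.sumCoact_eq h (fun a b => Q.proj (Q.tri a h') * b) (by fun_prop) (by fun_prop)
  simp only [QuasiHopf.sumPR_proj_tri] at e2
  simp only [QuasiHopf.circ_eq_proj _ (Q.tri _ _), ← QuasiHopf.tri_mul]
  simp only [← mul_assoc] at e
  rw [e, e2]
  simp only [QuasiHopf.circ_eq, QuasiHopf.tri_eq, QuasiHopf.S_mul, QuasiHopf.mul_sumΔ,
    QuasiHopf.sumΔ_mul, mul_assoc]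
end
end
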